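/- arXiv:2605.21985 — 8 statements merged into one kernel-verified Lean document; each statement's English description precedes it below -/
import Mathlib

section
/- The generating function W₂(θ₁,J₁,J₂) = (1/(4√2))·( ¼ e^{4θ₁} − 2J₁ e^{2θ₁} + 2J₁(J₁² + J₂²) e^{−2θ₁} − ¼ e^{−4θ₁}(J₁² + J₂²)² ) solves the homological equation for the first normal-form step of the champagne bottle: for all real θ₁, J₁, J₂, √2 · ∂W₂/∂θ₁ = ¼( e^{4θ₁} + e^{−4θ₁}(J₁² + J₂²)² − 4J₁ e^{2θ₁} − 4J₁(J₁² + J₂²) e^{−2θ₁} ); equivalently, H₂⁰(θ₁,J₁,J₂) := ½(3J₁² + J₂²) + ¼( e^{4θ₁} + e^{−4θ₁}(J₁²+J₂²)² − 4J₁e^{2θ₁} − 4J₁(J₁²+J₂²)e^{−2θ₁} ) equals ½(3J₁² + J₂²) + √2 ∂W₂/∂θ₁. -/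
/-- The generating function W₂ of the first normal-form step for the champagne bottle. -/
noncomputable def W₂fun (θ₁ J₁ J₂ : ℝ) : ℝ :=
  (1 / (4 * Real.sqrt 2)) *
    ((1/4) * Real.exp (4*θ₁) - 2 * J₁ * Real.exp (2*θ₁)
      + 2 * J₁ * (J₁^2 + J₂^2) * Real.exp (-(2*θ₁))
      - (1/4) * Real.exp (-(4*θ₁)) * (J₁^2 + J₂^2)^2)

/-- The partial derivative of W₂ in θ₁. -/
theorem hasDerivAt_W₂fun (θ₁ J₁ J₂ : ℝ) :
    HasDerivAt (fun s => W₂fun s J₁ J₂)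
      ((1 / (4 * Real.sqrt 2)) *
        (Real.exp (4*θ₁) + Real.exp (-(4*θ₁)) * (J₁^2 + J₂^2)^2
          - 4 * J₁ * Real.exp (2*θ₁) - 4 * J₁ * (J₁^2 + J₂^2) * Real.exp (-(2*θ₁)))) θ₁ := by
  have hlin (c : ℝ) : HasDerivAt (fun s : ℝ => c * s) c θ₁ := by
    simpa using (hasDerivAt_id θ₁).const_mul c
  unfold W₂fun
  refine HasDerivAt.const_mul _ ?_
  refine (((((hlin 4).exp.const_mul (1/4)).sub ((hlin 2).exp.const_mul (2 * J₁))).add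
    ((hlin 2).neg.exp.const_mul (2 * J₁ * (J₁^2 + J₂^2)))).sub
    (((hlin 4).neg.exp.const_mul (1/4)).mul_const ((J₁^2 + J₂^2)^2))).congr_deriv ?_
  simp only [Pi.neg_apply]
  ring

/-- W₂ solves the homological equation of the first normal-form step:
√2 ∂W₂/∂θ₁ equals the θ₁-dependent part of H₂⁰, and hence
H₂⁰ = ½(3J₁² + J₂²) + √2 ∂W₂/∂θ₁. -/
theorem champagne_bottle_homological_equation (θ₁ J₁ J₂ : ℝ) :
    (Real.sqrt 2 * deriv (fun s => W₂fun s J₁ J₂) θ₁ =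
      (1/4) * (Real.exp (4*θ₁) + Real.exp (-(4*θ₁)) * (J₁^2 + J₂^2)^2
        - 4 * J₁ * Real.exp (2*θ₁) - 4 * J₁ * (J₁^2 + J₂^2) * Real.exp (-(2*θ₁)))) ∧
    ((1/2) * (3 * J₁^2 + J₂^2) +
      (1/4) * (Real.exp (4*θ₁) + Real.exp (-(4*θ₁)) * (J₁^2 + J₂^2)^2
        - 4 * J₁ * Real.exp (2*θ₁) - 4 * J₁ * (J₁^2 + J₂^2) * Real.exp (-(2*θ₁))) =
      (1/2) * (3 * J₁^2 + J₂^2) + Real.sqrt 2 * deriv (fun s => W₂fun s J₁ J₂) θ₁) := by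
  have h := hasDerivAt_W₂fun θ₁ J₁ J₂
  have key : Real.sqrt 2 * deriv (fun s => W₂fun s J₁ J₂) θ₁ =
      (1/4) * (Real.exp (4*θ₁) + Real.exp (-(4*θ₁)) * (J₁^2 + J₂^2)^2
        - 4 * J₁ * Real.exp (2*θ₁) - 4 * J₁ * (J₁^2 + J₂^2) * Real.exp (-(2*θ₁))) := by
    rw [h.deriv]
    have h2 : Real.sqrt 2 ≠ 0 := by positivity
    field_simp
  exact ⟨key, by rw [key]⟩
end

section
/- The power series J₁(h, j₂) given in the paper inverts the scaled Birkhoff normal form of the champagne bottle up to total degree 4: let P(a,b) = a + (3a² + b²)/8 − (17a³ + 9ab²)/64 + (375a⁴ + 258a²b² + 11b⁴)/1024 − (10689a⁵ + 8910a³b² + 909ab⁴)/16384 and Q(h,b) = h − (3h² + b²)/8 + (35h³ + 15hb²)/64 − (1155h⁴ + 630h²b² + 35b⁴)/1024, as polynomials with rational coefficients. Then every monomial of total degree at most 4 in the two-variable polynomial P(Q(h,b), b) − h has coefficient zero. -/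
open MvPolynomial

/-- The scaled Birkhoff normal form P(a,b) of the champagne bottle, as a polynomial
expression in two commuting elements a, b of ℚ[h,b]. -/
noncomputable def Ppoly (a b : MvPolynomial (Fin 2) ℚ) : MvPolynomial (Fin 2) ℚ :=
  a + C (1/8) * (3 * a^2 + b^2) - C (1/64) * (17 * a^3 + 9 * a * b^2)
    + C (1/1024) * (375 * a^4 + 258 * a^2 * b^2 + 11 * b^4)
    - C (1/16384) * (10689 * a^5 + 8910 * a^3 * b^2 + 909 * a * b^4)

/-- The claimed inverse series Q(h,b) ∈ ℚ[h,b] (h = X 0, b = X 1). -/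
noncomputable def Qpoly : MvPolynomial (Fin 2) ℚ :=
  X 0 - C (1/8) * (3 * (X 0)^2 + (X 1)^2)
    + C (1/64) * (35 * (X 0)^3 + 15 * (X 0) * (X 1)^2)
    - C (1/1024) * (1155 * (X 0)^4 + 630 * (X 0)^2 * (X 1)^2 + 35 * (X 1)^4)

/-- The inversion identity with all denominators absorbed in powers of a parameter `t`
(standing for `1/16`), in a ring where the monomials of degree at least five vanish. -/
theorem normal_form_inverse_of_nilpotent {R : Type*} [CommRing R] {t x y q : R}
    (hx : x ^ 5 = 0) (hxy : x ^ 3 * y ^ 2 = 0) (hxy' : x * y ^ 4 = 0) (hy : y ^ 6 = 0)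
    (hq : q = x - 2 * t * (3 * x ^ 2 + y ^ 2) + 4 * t ^ 2 * (35 * x ^ 3 + 15 * x * y ^ 2)
      - 4 * t ^ 3 * (1155 * x ^ 4 + 630 * x ^ 2 * y ^ 2 + 35 * y ^ 4)) :
    q + 2 * t * (3 * q ^ 2 + y ^ 2) - 4 * t ^ 2 * (17 * q ^ 3 + 9 * q * y ^ 2)
      + 4 * t ^ 3 * (375 * q ^ 4 + 258 * q ^ 2 * y ^ 2 + 11 * y ^ 4)
      - 4 * t ^ 4 * (10689 * q ^ 5 + 8910 * q ^ 3 * y ^ 2 + 909 * q * y ^ 4) = x := by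
  have h2 : q ^ 2 = x ^ 2 - t * (12 * x ^ 3 + 4 * x * y ^ 2)
      + t ^ 2 * (316 * x ^ 4 + 144 * x ^ 2 * y ^ 2 + 4 * y ^ 4) := by
    rw [hq]; clear hq; grind
  have h3 : q ^ 3 = x ^ 3 - t * (18 * x ^ 4 + 6 * x ^ 2 * y ^ 2) := by
    rw [pow_succ, h2, hq]; clear h2 hq; grind
  have h4 : q ^ 4 = x ^ 4 := by
    rw [pow_succ, h3, hq]; clear h2 h3 hq; grind
  have h5 : q ^ 5 = 0 := by
    rw [pow_succ, h4, hq]; clear h2 h3 h4 hq; grind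
  rw [h2, h3, h4, h5, hq]
  clear h2 h3 h4 h5 hq
  grind

/-- Q inverts the scaled Birkhoff normal form P up to total degree 4:
every monomial of total degree ≤ 4 in P(Q(h,b), b) − h has zero coefficient. -/
theorem champagne_bottle_normal_form_inverse
    (m : Fin 2 →₀ ℕ) (hm : m 0 + m 1 ≤ 4) :
    MvPolynomial.coeff m (Ppoly Qpoly (X 1) - X 0) = 0 := by
  suffices h : Ppoly Qpoly (X 1) - X 0 ∈ idealOfVars (Fin 2) ℚ ^ 5 by
    refine (mem_pow_idealOfVars_iff' 5 _).1 h m ?_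
    rw [Finsupp.degree_eq_sum, Fin.sum_univ_two]
    lia
  have hX (i : Fin 2) : (X i : MvPolynomial (Fin 2) ℚ) ∈ idealOfVars (Fin 2) ℚ :=
    Ideal.subset_span ⟨i, rfl⟩
  have hmon (a b : ℕ) (hab : 5 ≤ a + b) :
      Ideal.Quotient.mk (idealOfVars (Fin 2) ℚ ^ 5) (X 0 ^ a * X 1 ^ b) = 0 := by
    rw [Ideal.Quotient.eq_zero_iff_mem]
    refine Ideal.pow_le_pow_right hab ?_
    rw [pow_add]
    exact Ideal.mul_mem_mul (Ideal.pow_mem_pow (hX 0) a) (Ideal.pow_mem_pow (hX 1) b)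
  have c8 : (C (1 / 8) : MvPolynomial (Fin 2) ℚ) = 2 * C (1 / 16) := by
    rw [← map_ofNat C 2, ← C_mul]; norm_num
  have c64 : (C (1 / 64) : MvPolynomial (Fin 2) ℚ) = 4 * C (1 / 16) ^ 2 := by
    rw [← map_ofNat C 4, ← C_pow, ← C_mul]; norm_num
  have c1024 : (C (1 / 1024) : MvPolynomial (Fin 2) ℚ) = 4 * C (1 / 16) ^ 3 := by
    rw [← map_ofNat C 4, ← C_pow, ← C_mul]; norm_num
  have c16384 : (C (1 / 16384) : MvPolynomial (Fin 2) ℚ) = 4 * C (1 / 16) ^ 4 := by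
    rw [← map_ofNat C 4, ← C_pow, ← C_mul]; norm_num
  rw [← Ideal.Quotient.mk_eq_mk_iff_sub_mem]
  have key := normal_form_inverse_of_nilpotent
    (t := Ideal.Quotient.mk (idealOfVars (Fin 2) ℚ ^ 5) (C (1 / 16)))
    (q := Ideal.Quotient.mk (idealOfVars (Fin 2) ℚ ^ 5) Qpoly)
    (by simpa using hmon 5 0 le_rfl) (by simpa using hmon 3 2 le_rfl)
    (by simpa using hmon 1 4 le_rfl) (by simpa using hmon 0 6 (by lia))
    (by simp only [Qpoly, c8, c64, c1024, map_add, map_sub, map_mul, map_pow, map_ofNat])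
  simpa only [Ppoly, c8, c64, c1024, c16384, map_add, map_sub, map_mul, map_pow, map_ofNat]
    using key
end

section
/- Leading-order asymptotics of the roots of the champagne bottle cubic near the focus-focus point: fix real h and j₂ with j₂ ≠ 0. Then for all sufficiently small μ > 0 the cubic P_μ(z) = −2z³ + 2z² + 2μhz − μ²j₂²/2 has three distinct real roots z₁(μ) < z₂(μ) < z₃(μ), and as μ → 0⁺ one has z₁(μ)/μ → −(√(h² + j₂²) + h)/2, z₂(μ)/μ → (√(h² + j₂²) − h)/2, and z₃(μ) → 1. -/
open Filter Topology

/-- A simple nonzero root of `w² + h w - c` continues to a root of `w² + h w - c = μ w³`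
for small `μ`: near it, `μ` is a locally invertible function of `w`. -/
theorem exists_root_branch (h c w₀ : ℝ) (hw₀ : w₀ ≠ 0) (hroot : w₀ ^ 2 + h * w₀ - c = 0)
    (hsimple : 2 * w₀ + h ≠ 0) :
    ∃ φ : ℝ → ℝ, Tendsto φ (𝓝 0) (𝓝 w₀) ∧
      ∀ᶠ μ in 𝓝 0, φ μ ^ 2 + h * φ μ - c = μ * φ μ ^ 3 := by
  let g : ℝ → ℝ := fun w => (w ^ 2 + h * w - c) / w ^ 3
  have hg₀ : g w₀ = 0 := by simp [g, hroot]
  have hnum : HasStrictDerivAt (fun w : ℝ => w ^ 2 + h * w - c) (2 * w₀ + h) w₀ := by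
    have hder := (((hasStrictDerivAt_id w₀).fun_pow 2).fun_add
      ((hasStrictDerivAt_id w₀).const_mul h)).fun_sub (hasStrictDerivAt_const w₀ c)
    exact hder.congr_deriv (by simp)
  have hg : HasStrictDerivAt g ((2 * w₀ + h) / w₀ ^ 3) w₀ := by
    have hquot := hnum.fun_div ((hasStrictDerivAt_id w₀).fun_pow 3) (pow_ne_zero 3 hw₀)
    refine hquot.congr_deriv ?_
    simp only [id, hroot]
    field_simp
    ring
  have hg' : (2 * w₀ + h) / w₀ ^ 3 ≠ 0 := div_ne_zero hsimple (pow_ne_zero 3 hw₀)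
  have hF := hg.hasStrictFDerivAt_equiv hg'
  have hlim : Tendsto (hF.localInverse g _ w₀) (𝓝 0) (𝓝 w₀) := by
    simpa only [hg₀] using hF.localInverse_tendsto
  have hinv := hF.eventually_right_inverse
  rw [hg₀] at hinv
  refine ⟨_, hlim, ?_⟩
  filter_upwards [hinv, hlim.eventually_ne hw₀] with μ hμ hne
  exact (div_eq_iff (pow_ne_zero 3 hne)).1 hμ

/-- Two distinct roots of the rescaled cubic determine the factorization of the original one,
the third root being given by Vieta's formula. -/
theorem cubic_eq_of_two_roots {h j μ w₁ w₂ : ℝ} (hne : w₁ ≠ w₂)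
    (h₁ : w₁ ^ 2 + h * w₁ - j ^ 2 / 4 = μ * w₁ ^ 3)
    (h₂ : w₂ ^ 2 + h * w₂ - j ^ 2 / 4 = μ * w₂ ^ 3) (z : ℝ) :
    -2 * z ^ 3 + 2 * z ^ 2 + 2 * (μ * h) * z - (μ * j) ^ 2 / 2 =
      -2 * (z - μ * w₁) * (z - μ * w₂) * (z - (1 - μ * w₁ - μ * w₂)) := by
  have hh : w₁ + w₂ + h = μ * (w₁ ^ 2 + w₁ * w₂ + w₂ ^ 2) :=
    mul_left_cancel₀ (sub_ne_zero.2 hne) (by linear_combination h₁ - h₂)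
  linear_combination (2 * μ * z - 2 * μ ^ 2 * w₁) * hh + 2 * μ ^ 2 * h₁

/-- leading-order asymptotics of the roots of the champagne bottle cubic
near the focus-focus point. For fixed h and j₂ ≠ 0, for all small μ > 0 the cubic
P_μ(z) = −2z³ + 2z² + 2μhz − μ²j₂²/2 has three distinct real roots z₁(μ) < z₂(μ) < z₃(μ)
and, as μ → 0⁺, z₁(μ)/μ → −(√(h²+j₂²)+h)/2, z₂(μ)/μ → (√(h²+j₂²)−h)/2, z₃(μ) → 1. -/
theorem champagne_bottle_cubic_root_asymptotics (h j₂ : ℝ) (hj₂ : j₂ ≠ 0) :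
    ∃ (z₁ z₂ z₃ : ℝ → ℝ) (μ₀ : ℝ), 0 < μ₀ ∧
      (∀ μ : ℝ, 0 < μ → μ < μ₀ →
        z₁ μ < z₂ μ ∧ z₂ μ < z₃ μ ∧
        (∀ z : ℝ, -2 * z^3 + 2 * z^2 + 2 * (μ * h) * z - (μ * j₂)^2 / 2 =
          -2 * (z - z₁ μ) * (z - z₂ μ) * (z - z₃ μ))) ∧
      Tendsto (fun μ => z₁ μ / μ) (nhdsWithin 0 (Set.Ioi 0))
        (nhds (-(Real.sqrt (h^2 + j₂^2) + h) / 2)) ∧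
      Tendsto (fun μ => z₂ μ / μ) (nhdsWithin 0 (Set.Ioi 0))
        (nhds ((Real.sqrt (h^2 + j₂^2) - h) / 2)) ∧
      Tendsto z₃ (nhdsWithin 0 (Set.Ioi 0)) (nhds 1) := by
  set s := Real.sqrt (h ^ 2 + j₂ ^ 2)
  have hj : 0 < j₂ ^ 2 := by positivity
  have hs_sq : s ^ 2 = h ^ 2 + j₂ ^ 2 := Real.sq_sqrt (by positivity)
  have hs_pos : 0 < s := Real.sqrt_pos.2 (by positivity)
  have habs : |h| < s := abs_lt_of_sq_lt_sq (by linarith) hs_pos.le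
  obtain ⟨hlo, hhi⟩ := abs_lt.1 habs
  obtain ⟨φ₁, hφ₁, hr₁⟩ := exists_root_branch h (j₂ ^ 2 / 4) (-(s + h) / 2) (by linarith)
    (by linear_combination hs_sq / 4) (by linarith)
  obtain ⟨φ₂, hφ₂, hr₂⟩ := exists_root_branch h (j₂ ^ 2 / 4) ((s - h) / 2) (by linarith)
    (by linear_combination hs_sq / 4) (by linarith)
  have hid : Tendsto (fun μ : ℝ => μ) (𝓝 0) (𝓝 0) := tendsto_id
  have hz₂ : Tendsto (fun μ => μ * φ₂ μ) (𝓝 0) (𝓝 0) := by simpa using hid.mul hφ₂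
  have hz₃ : Tendsto (fun μ => 1 - μ * φ₁ μ - μ * φ₂ μ) (𝓝 0) (𝓝 1) := by
    simpa using ((hid.mul hφ₁).const_sub 1).sub hz₂
  have hlt₁₂ : ∀ᶠ μ in 𝓝 0, φ₁ μ < φ₂ μ := hφ₁.eventually_lt hφ₂ (by linarith)
  have hlt₂₃ := hz₂.eventually_lt hz₃ one_pos
  obtain ⟨μ₀, hμ₀, hball⟩ :=
    Metric.eventually_nhds_iff.1 (hr₁.and (hr₂.and (hlt₁₂.and hlt₂₃)))
  have hdiv (φ : ℝ → ℝ) {a : ℝ} (hφ : Tendsto φ (𝓝 0) (𝓝 a)) :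
      Tendsto (fun μ => μ * φ μ / μ) (𝓝[>] 0) (𝓝 a) := by
    refine (hφ.mono_left nhdsWithin_le_nhds).congr' ?_
    filter_upwards [self_mem_nhdsWithin] with μ (hμ : 0 < μ)
    rw [mul_div_cancel_left₀ _ hμ.ne']
  refine ⟨fun μ => μ * φ₁ μ, fun μ => μ * φ₂ μ, fun μ => 1 - μ * φ₁ μ - μ * φ₂ μ, μ₀, hμ₀, ?_,
    hdiv φ₁ hφ₁, hdiv φ₂ hφ₂, hz₃.mono_left nhdsWithin_le_nhds⟩
  intro μ hμ hμlt
  obtain ⟨h₁, h₂, h₁₂, h₂₃⟩ := hball (y := μ) (by simpa [abs_of_pos hμ] using hμlt)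
  exact ⟨mul_lt_mul_of_pos_left h₁₂ hμ, h₂₃, cubic_eq_of_two_roots h₁₂.ne h₁ h₂⟩
end

section
/- Reduction of the second-moment integral over the real oval to Legendre form: let z₁ < z₂ < z₃ be real numbers with z₁ + z₂ + z₃ = 1, set h = −(z₁z₂ + z₁z₃ + z₂z₃) and κ² = (z₃ − z₂)/(z₃ − z₁). Then ∫_{z₂}^{z₃} z² dz / √((z₃ − z)(z − z₂)(z − z₁)) = ((2h + 4z₁)/(3√(z₃ − z₁))) · K(κ) + (4/3)√(z₃ − z₁) · E(κ). -/
/-- Complete elliptic integral of the first kind in Legendre form. -/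
noncomputable def ellK (κ : ℝ) : ℝ :=
  ∫ t in (0:ℝ)..1, 1 / Real.sqrt ((1 - t^2) * (1 - κ^2 * t^2))

/-- Complete elliptic integral of the second kind in Legendre form. -/
noncomputable def ellE (κ : ℝ) : ℝ :=
  ∫ t in (0:ℝ)..1, Real.sqrt ((1 - κ^2 * t^2) / (1 - t^2))

open Set MeasureTheory intervalIntegral

/-- A continuous function divided by the Legendre square root is integrable on `[0, 1]`. -/
theorem intervalIntegrable_div_sqrt_legendre {κ : ℝ} (hκ : κ ^ 2 < 1) {g : ℝ → ℝ}
    (hg : Continuous g) :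
    IntervalIntegrable (fun t => g t / √((1 - t ^ 2) * (1 - κ ^ 2 * t ^ 2))) volume 0 1 := by
  have hw : IntervalIntegrable (fun t : ℝ => (√(1 - t ^ 2))⁻¹) volume 0 1 := by
    simp only [← Real.sqrt_inv]
    refine Polynomial.Chebyshev.intervalIntegrable_sqrt_one_sub_sq_inv.mono_set ?_
    rw [uIcc_of_le zero_le_one, uIcc_of_le (by norm_num)]
    exact Icc_subset_Icc (by norm_num) le_rfl
  have hc : ContinuousOn (fun t : ℝ => g t / √(1 - κ ^ 2 * t ^ 2)) (uIcc 0 1) := by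
    refine hg.continuousOn.div (by fun_prop) fun t ht => ?_
    rw [uIcc_of_le zero_le_one] at ht
    have : t ^ 2 ≤ 1 := pow_le_one₀ ht.1 ht.2
    exact (Real.sqrt_pos.2 (by nlinarith [sq_nonneg κ])).ne'
  refine (hw.mul_continuousOn hc).congr fun t ht => ?_
  rw [uIoc_of_le zero_le_one] at ht
  have : t ^ 2 ≤ 1 := pow_le_one₀ ht.1.le ht.2
  rw [Real.sqrt_mul (by linarith), div_mul_eq_div_div, div_right_comm,
    div_eq_inv_mul _ (√(1 - t ^ 2))]

/-- The second-kind integral written over the Legendre square root. -/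
theorem ellE_eq_integral_div_sqrt {κ : ℝ} (hκ : κ ^ 2 < 1) :
    ellE κ = ∫ t in (0 : ℝ)..1,
      (1 - κ ^ 2 * t ^ 2) / √((1 - t ^ 2) * (1 - κ ^ 2 * t ^ 2)) := by
  refine integral_congr_Ioo_of_le zero_le_one fun t ht => ?_
  have h1 : t ^ 2 < 1 := pow_lt_one₀ ht.1.le ht.2 two_ne_zero
  have h2 : 0 < 1 - κ ^ 2 * t ^ 2 := by nlinarith [sq_nonneg κ]
  rw [Real.sqrt_div h2.le, Real.sqrt_mul (by linarith), div_mul_eq_div_div_swap, Real.div_sqrt]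

/-- The integral of the derivative of `t √((1 - t²)(1 - κ²t²))` over `[0, 1]` vanishes. -/
theorem integral_deriv_mul_sqrt_legendre {κ : ℝ} (hκ : κ ^ 2 < 1) :
    ∫ t in (0 : ℝ)..1, (1 - 2 * (1 + κ ^ 2) * t ^ 2 + 3 * κ ^ 2 * t ^ 4) /
      √((1 - t ^ 2) * (1 - κ ^ 2 * t ^ 2)) = 0 := by
  rw [integral_eq_sub_of_hasDerivAt_of_le
    (f := fun t => t * √((1 - t ^ 2) * (1 - κ ^ 2 * t ^ 2))) zero_le_one (by fun_prop) ?_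
    (intervalIntegrable_div_sqrt_legendre hκ (by fun_prop))]
  · simp
  intro t ht
  have h1 : t ^ 2 < 1 := pow_lt_one₀ ht.1.le ht.2 two_ne_zero
  have hQ : 0 < (1 - t ^ 2) * (1 - κ ^ 2 * t ^ 2) :=
    mul_pos (by linarith) (by nlinarith [sq_nonneg κ])
  have hd : HasDerivAt (fun t : ℝ => (1 - t ^ 2) * (1 - κ ^ 2 * t ^ 2))
      (-(2 * t) * (1 - κ ^ 2 * t ^ 2) + (1 - t ^ 2) * -(κ ^ 2 * (2 * t))) t := by
    have hs : HasDerivAt (fun t : ℝ => t ^ 2) (2 * t) t := by simpa using hasDerivAt_pow 2 t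
    exact (hs.const_sub 1).mul ((hs.const_mul (κ ^ 2)).const_sub 1)
  refine ((hasDerivAt_id' t).mul (hd.sqrt hQ.ne')).congr_deriv ?_
  have hr := Real.sq_sqrt hQ.le
  have hr0 := (Real.sqrt_pos.2 hQ).ne'
  generalize √((1 - t ^ 2) * (1 - κ ^ 2 * t ^ 2)) = r at hr hr0 ⊢
  field_simp
  linear_combination hr

/-- Reduction of an even quartic over the Legendre square root to `K` and `E`. -/
theorem integral_sq_div_sqrt_legendre {κ : ℝ} (hκ : κ ^ 2 < 1) (b a : ℝ) :
    ∫ t in (0 : ℝ)..1, (b + a * (1 - κ ^ 2 * t ^ 2)) ^ 2 /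
      √((1 - t ^ 2) * (1 - κ ^ 2 * t ^ 2)) =
      (b ^ 2 - a ^ 2 * (1 - κ ^ 2) / 3) * ellK κ +
        (2 * b * a + 2 * a ^ 2 * (2 - κ ^ 2) / 3) * ellE κ := by
  have hK := (intervalIntegrable_div_sqrt_legendre hκ (g := fun _ => 1) (by fun_prop)).const_mul
    (b ^ 2 - a ^ 2 * (1 - κ ^ 2) / 3)
  have hE := (intervalIntegrable_div_sqrt_legendre hκ (g := fun t => 1 - κ ^ 2 * t ^ 2)
    (by fun_prop)).const_mul (2 * b * a + 2 * a ^ 2 * (2 - κ ^ 2) / 3)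
  have hD := (intervalIntegrable_div_sqrt_legendre hκ
    (g := fun t => 1 - 2 * (1 + κ ^ 2) * t ^ 2 + 3 * κ ^ 2 * t ^ 4)
    (by fun_prop)).const_mul (a ^ 2 * κ ^ 2 / 3)
  have hadd := intervalIntegral.integral_add (hK.add hE) hD
  rw [intervalIntegral.integral_add hK hE] at hadd
  simp only [intervalIntegral.integral_const_mul, integral_deriv_mul_sqrt_legendre hκ, mul_zero,
    add_zero, ← ellE_eq_integral_div_sqrt hκ] at hadd
  rw [ellK, ← hadd]
  refine integral_congr fun t _ => ?_
  ring

/-- The substitution `z = z₃ - (z₃ - z₂) t²` brings an integral over the real oval to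
Legendre form. -/
theorem integral_div_sqrt_cubic_eq {z₁ z₂ z₃ : ℝ} (h₁₂ : z₁ < z₂) (h₂₃ : z₂ < z₃)
    (g : ℝ → ℝ) :
    ∫ z in z₂..z₃, g z / √((z₃ - z) * (z - z₂) * (z - z₁)) =
      2 / √(z₃ - z₁) * ∫ t in (0 : ℝ)..1, g (z₃ - (z₃ - z₂) * t ^ 2) /
        √((1 - t ^ 2) * (1 - (z₃ - z₂) / (z₃ - z₁) * t ^ 2)) := by
  have hc : 0 < z₃ - z₂ := by linarith
  have ha : 0 < z₃ - z₁ := by linarith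
  have himage : (fun t : ℝ => z₃ - (z₃ - z₂) * t ^ 2) '' Ioo 0 1 = Ioo z₂ z₃ := by
    ext z
    constructor
    · rintro ⟨t, ht, rfl⟩
      have h0 : 0 < t ^ 2 := pow_pos ht.1 2
      have h1 : t ^ 2 < 1 := pow_lt_one₀ ht.1.le ht.2 two_ne_zero
      constructor <;> simp only <;> nlinarith
    · intro hz
      have h0 : 0 < (z₃ - z) / (z₃ - z₂) := div_pos (by linarith [hz.2]) hc
      refine ⟨√((z₃ - z) / (z₃ - z₂)), ⟨Real.sqrt_pos.2 h0, ?_⟩, ?_⟩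
      · rw [Real.sqrt_lt' one_pos, one_pow, div_lt_one hc]
        linarith [hz.1]
      · simp only
        rw [Real.sq_sqrt h0.le]
        field_simp
        ring
  have hinj : InjOn (fun t : ℝ => z₃ - (z₃ - z₂) * t ^ 2) (Ioo 0 1) := by
    intro s hs t ht hst
    have hsq : s ^ 2 = t ^ 2 := mul_left_cancel₀ hc.ne' (sub_right_injective hst)
    exact (pow_left_inj₀ hs.1.le ht.1.le two_ne_zero).1 hsq
  have hderiv : ∀ t ∈ Ioo (0 : ℝ) 1, HasDerivWithinAt (fun t : ℝ => z₃ - (z₃ - z₂) * t ^ 2)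
      (-((z₃ - z₂) * (2 * t))) (Ioo 0 1) t := by
    intro t _
    have hs : HasDerivAt (fun t : ℝ => t ^ 2) (2 * t) t := by simpa using hasDerivAt_pow 2 t
    exact ((hs.const_mul (z₃ - z₂)).const_sub z₃).hasDerivWithinAt
  rw [integral_of_le h₂₃.le, integral_Ioc_eq_integral_Ioo, ← himage,
    integral_image_eq_integral_abs_deriv_smul measurableSet_Ioo hderiv hinj,
    ← intervalIntegral.integral_const_mul, integral_of_le zero_le_one,
    integral_Ioc_eq_integral_Ioo]
  refine setIntegral_congr_fun measurableSet_Ioo fun t ht => ?_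
  have hroot : √((z₃ - (z₃ - (z₃ - z₂) * t ^ 2)) * (z₃ - (z₃ - z₂) * t ^ 2 - z₂) *
      (z₃ - (z₃ - z₂) * t ^ 2 - z₁)) = ((z₃ - z₂) * t) * (√(z₃ - z₁) *
        √((1 - t ^ 2) * (1 - (z₃ - z₂) / (z₃ - z₁) * t ^ 2))) := by
    rw [← Real.sqrt_mul ha.le, ← Real.sqrt_sq (mul_pos hc ht.1).le, ← Real.sqrt_mul (sq_nonneg _)]
    congr 1
    field_simp
    ring
  have ht0 := ht.1
  simp only [smul_eq_mul]
  rw [hroot, abs_neg, abs_of_pos (by positivity)]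
  have hct : (z₃ - z₂) * t ≠ 0 := by positivity
  rw [← mul_div_assoc, mul_comm (_ * t) (√_ * _), ← div_div, mul_left_comm (z₃ - z₂) 2 t,
    div_mul_div_comm, div_div, mul_right_comm 2, mul_div_mul_right _ _ hct]

/-- reduction of the second-moment integral over the real oval to
Legendre form, where z₁ + z₂ + z₃ = 1 and h = −(z₁z₂ + z₁z₃ + z₂z₃). -/
theorem second_moment_integral_reduction (z₁ z₂ z₃ h : ℝ)
    (h₁₂ : z₁ < z₂) (h₂₃ : z₂ < z₃)
    (hsum : z₁ + z₂ + z₃ = 1)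
    (hh : h = -(z₁ * z₂ + z₁ * z₃ + z₂ * z₃)) :
    ∫ z in z₂..z₃, z^2 / Real.sqrt ((z₃ - z) * (z - z₂) * (z - z₁)) =
      ((2 * h + 4 * z₁) / (3 * Real.sqrt (z₃ - z₁))) *
        ellK (Real.sqrt ((z₃ - z₂) / (z₃ - z₁)))
      + (4/3) * Real.sqrt (z₃ - z₁) * ellE (Real.sqrt ((z₃ - z₂) / (z₃ - z₁))) := by
  have ha : 0 < z₃ - z₁ := by linarith
  have hκ : √((z₃ - z₂) / (z₃ - z₁)) ^ 2 = (z₃ - z₂) / (z₃ - z₁) :=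
    Real.sq_sqrt (div_nonneg (by linarith) ha.le)
  have hlt : √((z₃ - z₂) / (z₃ - z₁)) ^ 2 < 1 := by
    rw [hκ, div_lt_one ha]
    linarith
  have hz (t : ℝ) : z₃ - (z₃ - z₂) * t ^ 2 =
      z₁ + (z₃ - z₁) * (1 - (z₃ - z₂) / (z₃ - z₁) * t ^ 2) := by
    field_simp
    ring
  have hJ := integral_sq_div_sqrt_legendre hlt z₁ (z₃ - z₁)
  rw [hκ] at hJ
  rw [integral_div_sqrt_cubic_eq h₁₂ h₂₃ fun z => z ^ 2]
  simp only [hz]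
  rw [hJ]
  have hr := Real.sq_sqrt ha.le
  have hr0 := (Real.sqrt_pos.2 ha).ne'
  obtain rfl : z₂ = 1 - z₁ - z₃ := by linarith
  have hcoefK : z₁ ^ 2 - (z₃ - z₁) ^ 2 * (1 - (z₃ - (1 - z₁ - z₃)) / (z₃ - z₁)) / 3 =
      (h + 2 * z₁) / 3 := by
    rw [hh]
    field_simp
    ring
  have hcoefE : 2 * z₁ * (z₃ - z₁) +
      2 * (z₃ - z₁) ^ 2 * (2 - (z₃ - (1 - z₁ - z₃)) / (z₃ - z₁)) / 3 =
      2 / 3 * √(z₃ - z₁) ^ 2 := by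
    rw [hr]
    field_simp
    ring
  rw [hcoefK, hcoefE]
  field_simp
  ring
end

section
/- Lemma 1 (elliptic representation of the non-trivial action of the champagne bottle): let h, j₂ be reals with j₂ ≠ 0 such that the cubic P(z) = −2z³ + 2z² + 2hz − j₂²/2 has three distinct real roots z₁ < z₂ < z₃ (so z₁ < 0 < z₂). Set κ² = (z₃ − z₂)/(z₃ − z₁) and n = (z₃ − z₂)/z₃. Then the (scaled) action satisfies 2π I₁(h, j₂) := √2 ∫_{z₂}^{z₃} √(P(z))/z dz = g₁ K(κ) + g₂ E(κ) + g₃ Π(n, κ), where g₁ = 4(2h + z₁)/(3√(z₃ − z₁)), g₂ = 4√(z₃ − z₁)/3, and g₃ = −j₂²/(z₃ √(z₃ − z₁)). -/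
/-- Complete elliptic integral of the third kind in Legendre form. -/
noncomputable def ellPi (n κ : ℝ) : ℝ :=
  ∫ t in (0:ℝ)..1, 1 / ((1 - n * t^2) * Real.sqrt ((1 - t^2) * (1 - κ^2 * t^2)))

open Set intervalIntegral

/-- The Legendre integrand of the first kind, with the squared modulus as parameter, is integrable
on the unit interval. -/
lemma intervalIntegrable_legendre {k : ℝ} (hk : k < 1) :
    IntervalIntegrable (fun t : ℝ => 1 / √((1 - t ^ 2) * (1 - k * t ^ 2)))
      MeasureTheory.volume 0 1 := by
  have hpos : ∀ t ∈ Icc (0 : ℝ) 1, 0 < 1 - k * t ^ 2 := by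
    intro t ht
    have h1 : t ^ 2 ≤ 1 := by nlinarith [ht.1, ht.2]
    rcases le_total k 0 with hk0 | hk0 <;> nlinarith [sq_nonneg t]
  have harcsin : IntervalIntegrable (fun t : ℝ => 1 / √(1 - t ^ 2)) MeasureTheory.volume 0 1 := by
    refine intervalIntegrable_deriv_of_nonneg (g := Real.arcsin)
      Real.continuous_arcsin.continuousOn (fun x hx => ?_) (fun x _ => by positivity)
    rw [min_eq_left zero_le_one, max_eq_right zero_le_one] at hx
    exact Real.hasDerivAt_arcsin (by linarith [hx.1]) hx.2.ne
  have hcont : ContinuousOn (fun t : ℝ => 1 / √(1 - k * t ^ 2)) (uIcc 0 1) := by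
    rw [uIcc_of_le zero_le_one]
    exact continuousOn_const.div (by fun_prop) fun t ht => (Real.sqrt_pos.2 (hpos t ht)).ne'
  refine (harcsin.continuousOn_mul hcont).congr fun t ht => ?_
  rw [uIoc_of_le zero_le_one] at ht
  have h1 : 0 ≤ 1 - t ^ 2 := by nlinarith [ht.1, ht.2]
  simp only [Real.sqrt_mul h1]
  rw [one_div_mul_one_div, mul_comm]

/-- The Legendre integrand of the second kind as a multiple of the one of the first kind. -/
lemma sqrt_div_eq_mul_one_div_sqrt_mul {a b : ℝ} (ha : 0 < a) (hb : 0 ≤ b) :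
    √(a / b) = a * (1 / √(b * a)) := by
  have h : √a ≠ 0 := (Real.sqrt_pos.2 ha).ne'
  rw [Real.sqrt_div ha.le, Real.sqrt_mul hb]
  nth_rewrite 2 [← Real.mul_self_sqrt ha.le]
  rw [mul_one_div, mul_div_mul_right _ _ h]

/-- Derivative of `t √((1 - t²)(1 - k t²))`. -/
lemma hasDerivAt_mul_sqrt_legendre {k t : ℝ} (hQ : 0 < (1 - t ^ 2) * (1 - k * t ^ 2)) :
    HasDerivAt (fun s : ℝ => s * √((1 - s ^ 2) * (1 - k * s ^ 2)))
      ((1 - 2 * (1 + k) * t ^ 2 + 3 * k * t ^ 4) * (1 / √((1 - t ^ 2) * (1 - k * t ^ 2)))) t := by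
  have hsq : HasDerivAt (fun s : ℝ => s ^ 2) (2 * t) t := by simpa using hasDerivAt_pow 2 t
  have hQd := (hsq.const_sub 1).mul ((hsq.const_mul k).const_sub 1)
  have h := (hasDerivAt_id t).mul (hQd.sqrt hQ.ne')
  refine h.congr_deriv ?_
  simp only [id, Pi.mul_apply]
  have hne := (Real.sqrt_pos.2 hQ).ne'
  have hs := Real.sq_sqrt hQ.le
  generalize √((1 - t ^ 2) * (1 - k * t ^ 2)) = q at hne hs ⊢
  field_simp
  rw [hs]
  ring

/-- The substitution `z = z₃ - (z₃ - z₂) t²` in the action integral. -/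
lemma integral_sqrt_cubic_div_eq {z₁ z₂ z₃ : ℝ} (hz₂ : 0 < z₂) (h₁₂ : z₁ < z₂) (h₂₃ : z₂ < z₃) :
    √2 * ∫ z in z₂..z₃, √(-2 * (z - z₁) * (z - z₂) * (z - z₃)) / z =
      ∫ t in (0 : ℝ)..1, 4 * √(z₃ - z₁) * (z₃ - z₂) ^ 2 * t ^ 2 *
        √((1 - t ^ 2) * (1 - (z₃ - z₂) / (z₃ - z₁) * t ^ 2)) / (z₃ - (z₃ - z₂) * t ^ 2) := by
  have ha : 0 < z₃ - z₁ := by linarith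
  have hd : 0 < z₃ - z₂ := by linarith
  have hsub := integral_comp_mul_deriv' (a := 0) (b := 1)
    (f := fun t : ℝ => z₃ - (z₃ - z₂) * t ^ 2) (f' := fun t => -((z₃ - z₂) * (2 * t)))
    (g := fun z => √(-2 * (z - z₁) * (z - z₂) * (z - z₃)) / z)
    (fun t _ => by simpa using ((hasDerivAt_pow 2 t).const_mul (z₃ - z₂)).const_sub z₃)
    (by fun_prop)
    (by
      refine ContinuousOn.div (by fun_prop) continuousOn_id ?_
      rintro _ ⟨t, ht, rfl⟩
      rw [uIcc_of_le zero_le_one] at ht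
      have : t ^ 2 ≤ 1 := by nlinarith [ht.1, ht.2]
      nlinarith)
  have hf0 : z₃ - (z₃ - z₂) * (0 : ℝ) ^ 2 = z₃ := by ring
  have hf1 : z₃ - (z₃ - z₂) * (1 : ℝ) ^ 2 = z₂ := by ring
  rw [hf0, hf1] at hsub
  rw [integral_symm, ← hsub, ← integral_neg, ← integral_const_mul]
  refine integral_congr fun t ht => ?_
  rw [uIcc_of_le zero_le_one] at ht
  have hP : -2 * (z₃ - (z₃ - z₂) * t ^ 2 - z₁) * (z₃ - (z₃ - z₂) * t ^ 2 - z₂) *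
      (z₃ - (z₃ - z₂) * t ^ 2 - z₃) =
      ((z₃ - z₂) * t) ^ 2 * (2 * ((z₃ - z₁) *
        ((1 - t ^ 2) * (1 - (z₃ - z₂) / (z₃ - z₁) * t ^ 2)))) := by
    field_simp
    ring
  simp only [Function.comp]
  rw [hP, Real.sqrt_mul (sq_nonneg _), Real.sqrt_sq (mul_nonneg hd.le ht.1),
    Real.sqrt_mul zero_le_two, Real.sqrt_mul ha.le]
  linear_combination (2 * √(z₃ - z₁) * (z₃ - z₂) ^ 2 * t ^ 2 *
        √((1 - t ^ 2) * (1 - (z₃ - z₂) / (z₃ - z₁) * t ^ 2)) / (z₃ - (z₃ - z₂) * t ^ 2)) *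
    Real.sq_sqrt (zero_le_two (α := ℝ))

/-- Lemma 1: the (scaled) non-trivial action of the champagne bottle,
2π I₁(h, j₂) = √2 ∫_{z₂}^{z₃} √(P(z))/z dz with
P(z) = −2z³ + 2z² + 2hz − j₂²/2 = −2(z − z₁)(z − z₂)(z − z₃) and z₁ < z₂ < z₃,
equals g₁ K(κ) + g₂ E(κ) + g₃ Π(n, κ), where κ² = (z₃−z₂)/(z₃−z₁), n = (z₃−z₂)/z₃,
g₁ = 4(2h + z₁)/(3√(z₃−z₁)), g₂ = 4√(z₃−z₁)/3, g₃ = −j₂²/(z₃√(z₃−z₁)). -/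
theorem champagne_bottle_action_elliptic (h j₂ z₁ z₂ z₃ : ℝ) (hj₂ : j₂ ≠ 0)
    (h₁₂ : z₁ < z₂) (h₂₃ : z₂ < z₃)
    (hfact : ∀ z : ℝ, -2 * z^3 + 2 * z^2 + 2 * h * z - j₂^2 / 2 =
      -2 * (z - z₁) * (z - z₂) * (z - z₃)) :
    Real.sqrt 2 *
      ∫ z in z₂..z₃,
        Real.sqrt (-2 * z^3 + 2 * z^2 + 2 * h * z - j₂^2 / 2) / z =
      (4 * (2 * h + z₁) / (3 * Real.sqrt (z₃ - z₁))) *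
        ellK (Real.sqrt ((z₃ - z₂) / (z₃ - z₁)))
      + (4 * Real.sqrt (z₃ - z₁) / 3) * ellE (Real.sqrt ((z₃ - z₂) / (z₃ - z₁)))
      + (-(j₂^2) / (z₃ * Real.sqrt (z₃ - z₁))) *
        ellPi ((z₃ - z₂) / z₃) (Real.sqrt ((z₃ - z₂) / (z₃ - z₁))) := by
  have hj : j₂ ^ 2 = -4 * (z₁ * z₂ * z₃) := by linarith [hfact 0]
  have hsum : z₁ = 1 - z₂ - z₃ := by linarith [hfact 0, hfact 1, hfact (-1), hfact 2]
  have hh : h = -(z₁ * z₂ + z₁ * z₃ + z₂ * z₃) := by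
    linarith [hfact 0, hfact 1, hfact (-1), hfact 2]
  have hprod : z₁ * z₂ * z₃ < 0 := by
    have := pow_pos (abs_pos.2 hj₂) 2
    rw [sq_abs] at this
    linarith
  have hz₃ : 0 < z₃ := by linarith
  have hz₂ : 0 < z₂ := by
    by_contra! hle
    have : 0 ≤ z₁ * z₂ := mul_nonneg_of_nonpos_of_nonpos (by linarith) hle
    nlinarith
  have ha : 0 < z₃ - z₁ := by linarith
  have hd : 0 < z₃ - z₂ := by linarith
  set k := (z₃ - z₂) / (z₃ - z₁) with hk
  have hk0 : 0 ≤ k := by positivity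
  have hk1 : k < 1 := by rw [hk, div_lt_one ha]; linarith
  have hka : k * (z₃ - z₁) = z₃ - z₂ := div_mul_cancel₀ _ ha.ne'
  have hz : ∀ t ∈ Icc (0 : ℝ) 1, 0 < z₃ - (z₃ - z₂) * t ^ 2 := by
    intro t ht
    have : t ^ 2 ≤ 1 := by nlinarith [ht.1, ht.2]
    nlinarith
  have hn : ∀ t : ℝ, 1 - (z₃ - z₂) / z₃ * t ^ 2 = (z₃ - (z₃ - z₂) * t ^ 2) / z₃ := by
    intro t
    field_simp
  have hcongr : ∀ z : ℝ, √(-2 * z ^ 3 + 2 * z ^ 2 + 2 * h * z - j₂ ^ 2 / 2) / z =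
      √(-2 * (z - z₁) * (z - z₂) * (z - z₃)) / z := fun z => by rw [hfact]
  simp only [hcongr]
  rw [integral_sqrt_cubic_div_eq hz₂ h₁₂ h₂₃, ← hk]
  set w : ℝ → ℝ := fun t => 1 / √((1 - t ^ 2) * (1 - k * t ^ 2)) with hw
  have hwi : IntervalIntegrable w MeasureTheory.volume 0 1 := intervalIntegrable_legendre hk1
  have hE : ellE √k = ∫ t in (0 : ℝ)..1, (1 - k * t ^ 2) * w t := by
    unfold ellE
    rw [Real.sq_sqrt hk0]
    refine integral_congr fun t ht => ?_
    rw [uIcc_of_le zero_le_one] at ht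
    have h1 : t ^ 2 ≤ 1 := by nlinarith [ht.1, ht.2]
    exact sqrt_div_eq_mul_one_div_sqrt_mul (by nlinarith) (by linarith)
  have hK : ellK √k = ∫ t in (0 : ℝ)..1, w t := by
    unfold ellK
    rw [Real.sq_sqrt hk0]
  have hPi : ellPi ((z₃ - z₂) / z₃) √k =
      ∫ t in (0 : ℝ)..1, z₃ / (z₃ - (z₃ - z₂) * t ^ 2) * w t := by
    unfold ellPi
    rw [Real.sq_sqrt hk0]
    refine integral_congr fun t _ => ?_
    simp only [hn, hw]
    rw [← one_div_mul_one_div, one_div_div]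
  have hEi : IntervalIntegrable (fun t => (1 - k * t ^ 2) * w t) MeasureTheory.volume 0 1 :=
    hwi.continuousOn_mul (by fun_prop)
  have hPii : IntervalIntegrable (fun t => z₃ / (z₃ - (z₃ - z₂) * t ^ 2) * w t)
      MeasureTheory.volume 0 1 := by
    refine hwi.continuousOn_mul (continuousOn_const.div (by fun_prop) fun t ht => ?_)
    rw [uIcc_of_le zero_le_one] at ht
    exact (hz t ht).ne'
  have hAi : IntervalIntegrable (fun t => 4 * √(z₃ - z₁) * (z₃ - z₂) ^ 2 * t ^ 2 *
      √((1 - t ^ 2) * (1 - k * t ^ 2)) / (z₃ - (z₃ - z₂) * t ^ 2)) MeasureTheory.volume 0 1 := by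
    refine ContinuousOn.intervalIntegrable (ContinuousOn.div (by fun_prop) (by fun_prop) ?_)
    intro t ht
    rw [uIcc_of_le zero_le_one] at ht
    exact (hz t ht).ne'
  rw [hK, hE, hPi, ← integral_const_mul, ← integral_const_mul, ← integral_const_mul,
    ← integral_add (hwi.const_mul _) (hEi.const_mul _),
    ← integral_add ((hwi.const_mul _).add (hEi.const_mul _)) (hPii.const_mul _), ← sub_eq_zero,
    ← integral_sub hAi (((hwi.const_mul _).add (hEi.const_mul _)).add (hPii.const_mul _))]
  refine (integral_eq_sub_of_hasDerivAt_of_le zero_le_one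
    (f := fun t : ℝ => -(4 / 3 * √(z₃ - z₁) * (z₃ - z₂)) *
      (t * √((1 - t ^ 2) * (1 - k * t ^ 2)))) (by fun_prop) (fun t ht => ?_)
    (hAi.sub (((hwi.const_mul _).add (hEi.const_mul _)).add (hPii.const_mul _)))).trans (by simp)
  have h1 : t ^ 2 < 1 := by nlinarith [ht.1, ht.2]
  have hQ : 0 < (1 - t ^ 2) * (1 - k * t ^ 2) := mul_pos (by linarith) (by nlinarith)
  refine ((hasDerivAt_mul_sqrt_legendre hQ).const_mul _).congr_deriv ?_
  have hzt := (hz t ⟨ht.1.le, ht.2.le⟩).ne'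
  have hq := Real.sq_sqrt hQ.le
  have hq0 := (Real.sqrt_pos.2 hQ).ne'
  have hr := Real.sq_sqrt ha.le
  have hr0 := (Real.sqrt_pos.2 ha).ne'
  simp only [hw, hh, hj]
  generalize √((1 - t ^ 2) * (1 - k * t ^ 2)) = q at hq hq0 ⊢
  generalize √(z₃ - z₁) = r at hr hr0 ⊢
  obtain rfl : z₁ = z₃ - r ^ 2 := by linarith
  have hz₂' : z₂ = z₃ - k * r ^ 2 := by linear_combination hka
  clear_value k
  subst hz₂'
  rw [show z₃ - (z₃ - k * r ^ 2) = k * r ^ 2 by ring] at hzt ⊢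
  obtain ⟨D, hD⟩ : ∃ D, D = z₃ - k * r ^ 2 * t ^ 2 := ⟨_, rfl⟩
  rw [← hD] at hzt ⊢
  obtain rfl : z₃ = D + k * r ^ 2 * t ^ 2 := by linarith
  field_simp
  rw [hq]
  linear_combination -D ^ 2 * hsum
end

section
/- Lemma 2, finite-order version (expansion of the non-trivial action near the focus-focus point): there is δ > 0 such that for every (h, j₂) with h > 0 and 0 < h² + j₂² < δ the cubic P(z) = −2z³ + 2z² + 2hz − j₂²/2 has three real roots z₁ < 0 ≤ z₂ < z₃, and the function A(h, j₂) := √2 ∫_{z₂}^{z₃} √(P(z))/z dz satisfies A(h, j₂) = 4/3 − π|j₂| + j₂ arctan(j₂/h) + (h − (3h² + j₂²)/8)·ln(16/√(h² + j₂²)) + h + (17h² + 3j₂²)/16 + R(h, j₂), where R(h, j₂)/(h² + j₂²) → 0 as (h, j₂) → (0, 0) within the half-plane {h > 0}. -/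
open Filter Topology

section Primitives

variable {α β u : ℝ}

lemma hasDerivAt_sqrt_add_mul_sqrt_sub (h₁ : 0 < u + α) (h₂ : 0 < u - β) :
    HasDerivAt (fun u => √(u + α) * √(u - β))
      ((2 * u + α - β) / (2 * (√(u + α) * √(u - β)))) u := by
  have hX := ((hasDerivAt_id u).add_const α).sqrt h₁.ne'
  have hY := ((hasDerivAt_id u).sub_const β).sqrt h₂.ne'
  refine (hX.mul hY).congr_deriv ?_
  have hX0 := Real.sqrt_pos.2 h₁
  have hY0 := Real.sqrt_pos.2 h₂
  simp only [id]
  field_simp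
  rw [Real.sq_sqrt h₁.le, Real.sq_sqrt h₂.le]
  ring

lemma hasDerivAt_log_sqrt_add_sqrt (h₁ : 0 < u + α) (h₂ : 0 < u - β) :
    HasDerivAt (fun u => Real.log (√(u + α) + √(u - β)))
      (1 / (2 * (√(u + α) * √(u - β)))) u := by
  have hX := ((hasDerivAt_id u).add_const α).sqrt h₁.ne'
  have hY := ((hasDerivAt_id u).sub_const β).sqrt h₂.ne'
  have hX0 := Real.sqrt_pos.2 h₁
  have hY0 := Real.sqrt_pos.2 h₂
  refine ((hX.add hY).log (by simp only [Pi.add_apply, id]; positivity)).congr_deriv ?_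
  simp only [id, Pi.add_apply]
  field_simp
  ring

lemma hasDerivAt_arctan_sqrt_ratio (hα : 0 < α) (hβ : 0 ≤ β) (hu : β < u) :
    HasDerivAt (fun u => √α * √β * Real.arctan (√α * √(u - β) / (√β * √(u + α))))
      (α * β / (2 * u * (√(u + α) * √(u - β)))) u := by
  rcases hβ.eq_or_lt with rfl | hβ
  · simpa using hasDerivAt_const u (0 : ℝ)
  have h₁ : 0 < u + α := by linarith
  have h₂ : 0 < u - β := by linarith
  have hu0 : 0 < u := by linarith
  have hX := ((hasDerivAt_id u).add_const α).sqrt h₁.ne'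
  have hY := ((hasDerivAt_id u).sub_const β).sqrt h₂.ne'
  have hX0 := Real.sqrt_pos.2 h₁
  have hY0 := Real.sqrt_pos.2 h₂
  have ha := Real.sqrt_pos.2 hα
  have hb := Real.sqrt_pos.2 hβ
  refine ((((hY.const_mul √α).div (hX.const_mul √β)
    (by simp only [id]; positivity)).arctan).const_mul (√α * √β)).congr_deriv ?_
  have eX := Real.sq_sqrt h₁.le
  have eY := Real.sq_sqrt h₂.le
  have eα := Real.sq_sqrt hα.le
  have eβ := Real.sq_sqrt hβ.le
  simp only [id, Pi.div_apply]
  generalize √(u + α) = X at *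
  generalize √(u - β) = Y at *
  generalize √α = a at *
  generalize √β = b at *
  have hne : b ^ 2 * X ^ 2 + a ^ 2 * Y ^ 2 = u * (α + β) := by
    rw [eX, eY, eα, eβ]; ring
  have e1 : 1 + (a * Y / (b * X)) ^ 2 = u * (α + β) / (b ^ 2 * X ^ 2) := by
    rw [← hne]; field_simp
  have e2 : X ^ 2 - Y ^ 2 = α + β := by rw [eX, eY]; ring
  have hs : 0 < α + β := by positivity
  rw [e1, ← eα, ← eβ]
  have e3 : a ^ 2 + b ^ 2 = X ^ 2 - Y ^ 2 := by rw [e2, eα, eβ]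
  have h3 : X ^ 2 - Y ^ 2 ≠ 0 := by rw [e2]; exact hs.ne'
  rw [e3]
  field_simp

/-- A primitive of `u ↦ Q / u - Q / 2`, where `Q = √(u + α) * √(u - β)`. -/
noncomputable def mainPrimitive (α β u : ℝ) : ℝ :=
  √(u + α) * √(u - β) * (1 - (2 * u + α - β) / 8)
    + (α - β + (α + β) ^ 2 / 8) * Real.log (√(u + α) + √(u - β))
    - 2 * (√α * √β * Real.arctan (√α * √(u - β) / (√β * √(u + α))))

lemma hasDerivAt_mainPrimitive (hα : 0 < α) (hβ : 0 ≤ β) (hu : β < u) :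
    HasDerivAt (mainPrimitive α β)
      (√(u + α) * √(u - β) / u - √(u + α) * √(u - β) / 2) u := by
  have h₁ : 0 < u + α := by linarith
  have h₂ : 0 < u - β := by linarith
  have hu0 : 0 < u := by linarith
  have hlin : HasDerivAt (fun u : ℝ => 1 - (2 * u + α - β) / 8) (-(1 / 4)) u := by
    refine (((((hasDerivAt_id u).const_mul 2).add_const α).sub_const β).div_const 8
      |>.const_sub 1).congr_deriv ?_
    norm_num
  refine ((((hasDerivAt_sqrt_add_mul_sqrt_sub h₁ h₂).mul hlin).add
    ((hasDerivAt_log_sqrt_add_sqrt h₁ h₂).const_mul (α - β + (α + β) ^ 2 / 8))).sub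
    ((hasDerivAt_arctan_sqrt_ratio hα hβ hu).const_mul 2)).congr_deriv ?_
  have hX0 := Real.sqrt_pos.2 h₁
  have hY0 := Real.sqrt_pos.2 h₂
  have eX := Real.sq_sqrt h₁.le
  have eY := Real.sq_sqrt h₂.le
  generalize √(u + α) = X at *
  generalize √(u - β) = Y at *
  field_simp
  rw [eX, eY]
  ring

lemma continuousOn_mainPrimitive (hα : 0 < α) (hβ : 0 ≤ β) :
    ContinuousOn (mainPrimitive α β) (Set.Icc β 1) := by
  have hX : ∀ u ∈ Set.Icc β 1, 0 < √(u + α) := fun u hu =>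
    Real.sqrt_pos.2 (by linarith [hu.1])
  have hlog : ContinuousOn (fun u => Real.log (√(u + α) + √(u - β))) (Set.Icc β 1) := by
    refine ContinuousOn.log (by fun_prop) fun u hu => ?_
    have := hX u hu
    positivity
  have harctan : ContinuousOn
      (fun u => √α * √β * Real.arctan (√α * √(u - β) / (√β * √(u + α)))) (Set.Icc β 1) := by
    rcases hβ.eq_or_lt with rfl | hβ
    · simpa using continuousOn_const
    refine continuousOn_const.mul (Real.continuous_arctan.comp_continuousOn ?_)
    refine ContinuousOn.div (by fun_prop) (by fun_prop) fun u hu => ?_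
    have := hX u hu
    have := Real.sqrt_pos.2 hβ
    positivity
  exact ((by fun_prop : ContinuousOn
    (fun u => √(u + α) * √(u - β) * (1 - (2 * u + α - β) / 8)) (Set.Icc β 1)).add
    (continuousOn_const.mul hlog)).sub (continuousOn_const.mul harctan)

lemma mainPrimitive_self (h : 0 < α + β) :
    mainPrimitive α β β = ((α - β) / 2 + (α + β) ^ 2 / 16) * Real.log (α + β) := by
  simp only [mainPrimitive, sub_self, Real.sqrt_zero, mul_zero, zero_mul, zero_div,
    Real.arctan_zero, add_zero, add_comm β α, Real.log_sqrt h.le]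
  ring

lemma intervalIntegrable_div_sub_half (hα : 0 < α) (hβ : 0 ≤ β) (hβ1 : β ≤ 1) :
    IntervalIntegrable (fun u => √(u + α) * √(u - β) / u - √(u + α) * √(u - β) / 2)
      MeasureTheory.volume β 1 := by
  refine intervalIntegral.intervalIntegrable_deriv_of_nonneg (g := mainPrimitive α β)
    (by rw [Set.uIcc_of_le hβ1]; exact continuousOn_mainPrimitive hα hβ)
    (fun u hu => ?_) (fun u hu => ?_)
  · rw [min_eq_left hβ1] at hu
    exact hasDerivAt_mainPrimitive hα hβ hu.1
  · rw [min_eq_left hβ1, max_eq_right hβ1] at hu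
    have hu0 : 0 < u := hβ.trans_lt hu.1
    rw [sub_nonneg]
    exact div_le_div_of_nonneg_left (by positivity) hu0 (by linarith [hu.2])

lemma integral_div_sub_half (hα : 0 < α) (hβ : 0 ≤ β) (hβ1 : β ≤ 1) :
    ∫ u in β..1, (√(u + α) * √(u - β) / u - √(u + α) * √(u - β) / 2) =
      mainPrimitive α β 1 - mainPrimitive α β β :=
  intervalIntegral.integral_eq_sub_of_hasDerivAt_of_le hβ1 (continuousOn_mainPrimitive hα hβ)
    (fun _ hu => hasDerivAt_mainPrimitive hα hβ hu.1)
    (intervalIntegrable_div_sub_half hα hβ hβ1)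

end Primitives

section Remainder

/-- The weight in `√(1 - u) = 1 - u / 2 - u ^ 2 * sqrtWeight u`. -/
noncomputable def sqrtWeight (u : ℝ) : ℝ := 1 / (2 * (1 + √(1 - u)) ^ 2)

lemma continuous_sqrtWeight : Continuous sqrtWeight := by
  unfold sqrtWeight
  refine continuous_const.div (by fun_prop) fun u => ?_
  positivity

lemma sqrtWeight_nonneg (u : ℝ) : 0 ≤ sqrtWeight u := by
  unfold sqrtWeight
  positivity

lemma sqrtWeight_le_half (u : ℝ) : sqrtWeight u ≤ 1 / 2 := by
  unfold sqrtWeight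
  have := Real.sqrt_nonneg (1 - u)
  exact one_div_le_one_div_of_le (by norm_num) (by nlinarith)

lemma sqrt_one_sub_eq {u : ℝ} (hu : u ≤ 1) : √(1 - u) = 1 - u / 2 - u ^ 2 * sqrtWeight u := by
  unfold sqrtWeight
  have h0 := Real.sqrt_nonneg (1 - u)
  have h1 := Real.sq_sqrt (sub_nonneg.2 hu)
  have hu' : u = 1 - √(1 - u) ^ 2 := by rw [h1]; ring
  generalize √(1 - u) = s at *
  subst hu'
  field_simp
  ring

lemma integral_quadratic_mul_sqrtWeight (m k : ℝ) :
    ∫ u in (0 : ℝ)..1, (u ^ 2 + m * u - k) * sqrtWeight u =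
      1 / 12 + m * (3 / 2 - 2 * Real.log 2) - k * (Real.log 2 - 1 / 2) := by
  set G : ℝ → ℝ := fun s => -(s ^ 2 / 2 - 2 * s ^ 3 / 3 + s ^ 4 / 4
    + m * (-s ^ 2 / 2 + 2 * s - 2 * Real.log (1 + s))
    - k * (Real.log (1 + s) + (1 + s)⁻¹)) with hG
  have hGd : ∀ s : ℝ, 0 ≤ s → HasDerivAt G
      (-(s - 2 * s ^ 2 + s ^ 3 + m * (-s + 2 - 2 * (1 + s)⁻¹)
        - k * ((1 + s)⁻¹ - ((1 + s) ^ 2)⁻¹))) s := by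
    intro s hs
    have hne : (1 + s) ≠ 0 := by positivity
    have hid := hasDerivAt_id s
    have hl := (hid.const_add 1).log hne
    have hi := (hid.const_add 1).inv hne
    refine ((((((hasDerivAt_pow 2 s).div_const 2).sub
      (((hasDerivAt_pow 3 s).const_mul 2).div_const 3)).add
      ((hasDerivAt_pow 4 s).div_const 4)).add
      (((((hasDerivAt_pow 2 s).neg.div_const 2).add (hid.const_mul 2)).sub
        (hl.const_mul 2)).const_mul m)).sub ((hl.add hi).const_mul k)).neg.congr_deriv ?_
    simp only [id]
    field_simp
    ring
  have hcont : ContinuousOn (fun u => G √(1 - u)) (Set.Icc 0 1) := fun u _ =>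
    (ContinuousAt.comp (f := fun u => √(1 - u)) (g := G)
      (hGd _ (Real.sqrt_nonneg _)).continuousAt (by fun_prop)).continuousWithinAt
  rw [intervalIntegral.integral_eq_sub_of_hasDerivAt_of_le (f := fun u => G √(1 - u))
    zero_le_one hcont (fun u hu => ?_)
    (f' := fun u => (u ^ 2 + m * u - k) * sqrtWeight u)
    (((by fun_prop : Continuous fun u : ℝ => u ^ 2 + m * u - k).mul
      continuous_sqrtWeight).intervalIntegrable 0 1)]
  · simp only [hG, sub_self, Real.sqrt_zero, sub_zero, Real.sqrt_one, add_zero, Real.log_one,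
      one_add_one_eq_two]
    ring
  · have hpos : 0 < 1 - u := by linarith [hu.2]
    have hs := ((hasDerivAt_id u).const_sub 1).sqrt hpos.ne'
    refine (HasDerivAt.comp u (h₂ := G) (h := fun y => √(1 - y))
      (hGd _ (Real.sqrt_nonneg _)) hs).congr_deriv ?_
    have h0 := Real.sqrt_pos.2 hpos
    have h1 := Real.sq_sqrt hpos.le
    have hu' : u = 1 - √(1 - u) ^ 2 := by rw [h1]; ring
    unfold sqrtWeight
    simp only [id]
    generalize √(1 - u) = s at *
    subst hu'
    field_simp
    ring

lemma abs_sqrt_mul_sqrt_sub_le {α β u : ℝ} (hα : 0 < α) (hβ : 0 ≤ β) (hu : 0 < u) :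
    |√(u + α) * √(u - β) * u - (u ^ 2 + (α - β) / 2 * u - (α + β) ^ 2 / 8)| ≤
      4 * ((α + β) ^ 2 * √(α + β)) / √u := by
  have hσ : 0 < α + β := by linarith
  have hsu := Real.sqrt_pos.2 hu
  have hsσ := Real.sqrt_pos.2 hσ
  have hX := Real.sqrt_nonneg (u + α)
  have hY := Real.sqrt_nonneg (u - β)
  have hX2 := Real.sq_sqrt (by linarith : 0 ≤ u + α)
  rw [le_div_iff₀ hsu]
  rcases le_or_gt (α + β) u with hc | hc
  · have hY2 := Real.sq_sqrt (by linarith : 0 ≤ u - β)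
    have hle : √(α + β) ≤ √u := Real.sqrt_le_sqrt hc
    have hsq : √u * √u = u := Real.mul_self_sqrt hu.le
    have hss : √(α + β) * √(α + β) = α + β := Real.mul_self_sqrt hσ.le
    set Q := √(u + α) * √(u - β) with hQ
    have hQ0 : 0 ≤ Q := by positivity
    have hQ2 : Q ^ 2 = (u + α) * (u - β) := by rw [hQ, mul_pow, hX2, hY2]
    set D := u ^ 2 + (α - β) / 2 * u - (α + β) ^ 2 / 8 with hD
    have hDpos : 3 / 8 * u ^ 2 ≤ D := by
      rw [hD]; nlinarith [mul_nonneg hα.le hu.le, mul_nonneg hβ hu.le]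
    have hprod : (Q * u - D) * (Q * u + D) =
        (α + β) ^ 2 * ((α - β) * u / 8 - (α + β) ^ 2 / 64) := by
      have : (Q * u - D) * (Q * u + D) = Q ^ 2 * u ^ 2 - D ^ 2 := by ring
      rw [this, hQ2, hD]; ring
    have hin : |(α - β) * u / 8 - (α + β) ^ 2 / 64| ≤ 9 / 64 * (α + β) * u := by
      rw [abs_le]; constructor <;> nlinarith [mul_nonneg hα.le hu.le, mul_nonneg hβ hu.le]
    have h1 : |Q * u - D| * (3 / 8 * u ^ 2) ≤ (α + β) ^ 2 * (9 / 64 * (α + β) * u) := by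
      calc |Q * u - D| * (3 / 8 * u ^ 2) ≤ |Q * u - D| * |Q * u + D| := by
            refine mul_le_mul_of_nonneg_left ?_ (abs_nonneg _)
            exact (hDpos.trans (by nlinarith)).trans (le_abs_self _)
        _ = (α + β) ^ 2 * |(α - β) * u / 8 - (α + β) ^ 2 / 64| := by
            rw [← abs_mul, hprod, abs_mul, abs_of_nonneg (sq_nonneg (α + β))]
        _ ≤ _ := mul_le_mul_of_nonneg_left hin (sq_nonneg _)
    have h2 : |Q * u - D| * u ≤ 4 * (α + β) ^ 3 := by
      have : |Q * u - D| * u * (3 / 8 * u) ≤ 4 * (α + β) ^ 3 * (3 / 8 * u) := by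
        have : 0 ≤ (α + β) ^ 3 * u := by positivity
        nlinarith
      exact le_of_mul_le_mul_right this (by positivity)
    have h3 : |Q * u - D| * √u * √u ≤ 4 * ((α + β) ^ 2 * √(α + β)) * √u := by
      calc |Q * u - D| * √u * √u = |Q * u - D| * u := by rw [mul_assoc, hsq]
        _ ≤ 4 * (α + β) ^ 3 := h2
        _ = 4 * ((α + β) ^ 2 * √(α + β)) * √(α + β) := by
            rw [mul_assoc 4, mul_assoc ((α + β) ^ 2), hss]; ring
        _ ≤ _ := by gcongr
    exact le_of_mul_le_mul_right h3 hsu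
  · have hQ : √(u + α) * √(u - β) ≤ 2 * (α + β) := by
      have h1 : √(u + α) ≤ √(2 * (α + β)) := Real.sqrt_le_sqrt (by linarith)
      have h2 : √(u - β) ≤ √(2 * (α + β)) := Real.sqrt_le_sqrt (by linarith)
      calc _ ≤ √(2 * (α + β)) * √(2 * (α + β)) := by gcongr
        _ = _ := Real.mul_self_sqrt (by positivity)
    have hQ0 : 0 ≤ √(u + α) * √(u - β) := by positivity
    have h4 : |√(u + α) * √(u - β) * u - (u ^ 2 + (α - β) / 2 * u - (α + β) ^ 2 / 8)| ≤
        4 * (α + β) ^ 2 := by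
      generalize √(u + α) * √(u - β) = Q at *
      have e1 : Q * u ≤ 2 * (α + β) * (α + β) := by gcongr
      have e2 : 0 ≤ Q * u := by positivity
      have e3 : u ^ 2 ≤ (α + β) ^ 2 := by gcongr
      have e4 : |(α - β) / 2 * u| ≤ (α + β) / 2 * (α + β) := by
        rw [abs_mul, abs_of_pos hu]
        gcongr
        rw [abs_le]; constructor <;> linarith
      have := abs_le.1 e4
      rw [abs_le]; constructor <;> nlinarith [sq_nonneg u]
    have hle : √u ≤ √(α + β) := Real.sqrt_le_sqrt hc.le
    calc _ ≤ 4 * (α + β) ^ 2 * √(α + β) := by gcongr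
      _ = _ := by ring

lemma abs_integral_mul_sqrtWeight_sub_le {α β : ℝ} (hα : 0 < α) (hβ : 0 ≤ β) :
    |(∫ u in β..1, √(u + α) * √(u - β) * u * sqrtWeight u) -
      (1 / 12 + (α - β) / 2 * (3 / 2 - 2 * Real.log 2)
        - (α + β) ^ 2 / 8 * (Real.log 2 - 1 / 2))| ≤ 4 * ((α + β) ^ 2 * √(α + β)) := by
  have hc : Continuous fun u => √(u + α) * √(u - β) * u * sqrtWeight u :=
    (by fun_prop : Continuous fun u => √(u + α) * √(u - β) * u).mul continuous_sqrtWeight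
  have hext : ∫ u in β..1, √(u + α) * √(u - β) * u * sqrtWeight u =
      ∫ u in (0 : ℝ)..1, √(u + α) * √(u - β) * u * sqrtWeight u := by
    rw [← intervalIntegral.integral_add_adjacent_intervals (hc.intervalIntegrable 0 β)
      (hc.intervalIntegrable β 1), intervalIntegral.integral_congr (a := 0) (b := β)
      (g := fun _ => (0 : ℝ)), intervalIntegral.integral_zero, zero_add]
    intro u hu
    rw [Set.uIcc_of_le hβ] at hu
    simp [Real.sqrt_eq_zero_of_nonpos (sub_nonpos.2 hu.2)]
  have hc' : Continuous fun u : ℝ =>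
      (u ^ 2 + (α - β) / 2 * u - (α + β) ^ 2 / 8) * sqrtWeight u :=
    (by fun_prop : Continuous fun u : ℝ => u ^ 2 + (α - β) / 2 * u - (α + β) ^ 2 / 8).mul
      continuous_sqrtWeight
  rw [hext, ← integral_quadratic_mul_sqrtWeight, ← intervalIntegral.integral_sub
    (hc.intervalIntegrable 0 1) (hc'.intervalIntegrable 0 1), ← Real.norm_eq_abs]
  set M := (α + β) ^ 2 * √(α + β) with hM
  have hM0 : 0 ≤ M := by have := Real.sqrt_nonneg (α + β); positivity
  have hint : ∫ u in (0 : ℝ)..1, 2 * M * u ^ (-(1 / 2) : ℝ) = 4 * M := by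
    rw [intervalIntegral.integral_const_mul, integral_rpow (by norm_num)]
    norm_num
    ring
  rw [← hint]
  refine intervalIntegral.norm_integral_le_of_norm_le zero_le_one
    (Eventually.of_forall fun u hu => ?_)
    ((intervalIntegral.intervalIntegrable_rpow' (by norm_num)).const_mul _)
  have hu0 : 0 < u := hu.1
  have hb := abs_sqrt_mul_sqrt_sub_le hα hβ hu0
  rw [← sub_mul, norm_mul, Real.norm_eq_abs, Real.norm_eq_abs,
    abs_of_nonneg (sqrtWeight_nonneg u), Real.rpow_neg hu0.le, ← Real.sqrt_eq_rpow]
  calc _ ≤ 4 * M / √u * (1 / 2) := by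
        gcongr
        · exact sqrtWeight_nonneg u
        · exact sqrtWeight_le_half u
    _ = _ := by ring

end Remainder

/-- The action integral in scaled variables, up to an error of order `(α + β) ^ (5 / 2)`. -/
lemma abs_integral_sub_mainPrimitive_le {α β : ℝ} (hα : 0 < α) (hβ : 0 ≤ β) (hβ1 : β ≤ 1) :
    |(∫ u in β..1, √((u + α) * (u - β) * (1 - u)) / u) -
      (mainPrimitive α β 1 - mainPrimitive α β β -
      (1 / 12 + (α - β) / 2 * (3 / 2 - 2 * Real.log 2)
        - (α + β) ^ 2 / 8 * (Real.log 2 - 1 / 2)))| ≤ 4 * ((α + β) ^ 2 * √(α + β)) := by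
  have hc : Continuous fun u => √(u + α) * √(u - β) * u * sqrtWeight u :=
    (by fun_prop : Continuous fun u => √(u + α) * √(u - β) * u).mul continuous_sqrtWeight
  have hsplit : ∫ u in β..1, √((u + α) * (u - β) * (1 - u)) / u =
      (mainPrimitive α β 1 - mainPrimitive α β β) -
        ∫ u in β..1, √(u + α) * √(u - β) * u * sqrtWeight u := by
    rw [← integral_div_sub_half hα hβ hβ1, ← intervalIntegral.integral_sub
      (intervalIntegrable_div_sub_half hα hβ hβ1) (hc.intervalIntegrable β 1)]
    refine intervalIntegral.integral_congr fun u hu => ?_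
    rw [Set.uIcc_of_le hβ1] at hu
    have h₁ : 0 ≤ u + α := by linarith [hu.1]
    have h₂ : 0 ≤ u - β := by linarith [hu.1]
    rw [Real.sqrt_mul (mul_nonneg h₁ h₂), Real.sqrt_mul h₁, sqrt_one_sub_eq hu.2]
    rcases (hβ.trans hu.1).eq_or_lt with rfl | hu0
    · have : β = 0 := le_antisymm hu.1 hβ
      simp [this]
    · field_simp
  have := abs_integral_mul_sqrtWeight_sub_le hα hβ
  rw [hsplit, abs_sub_comm]
  convert this using 2
  ring

section ComplexLog

lemma arg_mk_of_pos {x y : ℝ} (hx : 0 < x) : (⟨x, y⟩ : ℂ).arg = Real.arctan (y / x) := by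
  have h1 := Complex.tan_arg (⟨x, y⟩ : ℂ)
  have h2 := Complex.abs_arg_lt_pi_div_two_iff.2 (Or.inl hx : 0 < (⟨x, y⟩ : ℂ).re ∨ _)
  rw [← Real.arctan_tan (abs_lt.1 h2).1 (abs_lt.1 h2).2, h1]

/-- First-order comparison of `Re (w * log w)` with `Re (w * log w')` for `w'` close to `w`. -/
lemma abs_re_mul_log_sub_le {w w' : ℂ} (hw : w ≠ 0) (hw' : w' ≠ 0)
    (harg : |w.arg - w'.arg| < Real.pi) (hpi : w'.arg ≠ Real.pi)
    (hd : ‖w - w'‖ ≤ ‖w'‖ / 2) :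
    |w.re * (Real.log ‖w‖ - Real.log ‖w'‖) - w.im * (w.arg - w'.arg) - (w - w').re| ≤
        3 * (‖w - w'‖ ^ 2 / ‖w'‖) ∧
      |Real.log ‖w‖ - Real.log ‖w'‖| ≤ 2 * (‖w - w'‖ / ‖w'‖) := by
  have hn : 0 < ‖w'‖ := norm_pos_iff.2 hw'
  set z := (w - w') / w' with hz
  have hwz : w = w' * (1 + z) := by rw [hz]; field_simp; ring
  have hnz : ‖z‖ = ‖w - w'‖ / ‖w'‖ := norm_div _ _
  have hz2 : ‖z‖ ≤ 1 / 2 := by rw [hnz, div_le_iff₀ hn]; linarith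
  have hlog : Complex.log (1 + z) = Complex.log w - Complex.log w' := by
    have h1 : (1 + z) = w * w'⁻¹ := by rw [hz]; field_simp; ring
    have h2 : (w'⁻¹).arg = -w'.arg := by rw [Complex.arg_inv, if_neg hpi]
    rw [h1, Complex.log_mul hw (inv_ne_zero hw'), Complex.log_inv _ hpi, sub_eq_add_neg]
    rw [h2]
    exact ⟨by linarith [(abs_lt.1 harg).1], by linarith [(abs_lt.1 harg).2]⟩
  have hlre : (Complex.log (1 + z)).re = Real.log ‖w‖ - Real.log ‖w'‖ := by
    rw [hlog, Complex.sub_re, Complex.log_re, Complex.log_re]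
  have hlim : (Complex.log (1 + z)).im = w.arg - w'.arg := by
    rw [hlog, Complex.sub_im, Complex.log_im, Complex.log_im]
  have hE : ‖Complex.log (1 + z) - z‖ ≤ ‖z‖ ^ 2 := by
    refine (Complex.norm_log_one_add_sub_self_le (by linarith)).trans ?_
    have : (1 - ‖z‖)⁻¹ ≤ 2 := by
      rw [inv_le_comm₀ (by linarith) (by norm_num)]; linarith
    nlinarith [sq_nonneg ‖z‖]
  rw [← hlre, ← hlim, ← Complex.mul_re, ← Complex.sub_re]
  constructor
  · have h1 : w * Complex.log (1 + z) - (w - w') =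
        w' * ((1 + z) * (Complex.log (1 + z) - z) + z ^ 2) := by
      nth_rewrite 1 [hwz]
      have : w - w' = w' * z := by rw [hz]; field_simp
      rw [this]; ring
    calc _ ≤ ‖w * Complex.log (1 + z) - (w - w')‖ := Complex.abs_re_le_norm _
      _ = ‖w'‖ * ‖(1 + z) * (Complex.log (1 + z) - z) + z ^ 2‖ := by rw [h1, norm_mul]
      _ ≤ ‖w'‖ * (2 * ‖z‖ ^ 2 + ‖z‖ ^ 2) := by
          gcongr
          refine (norm_add_le _ _).trans ?_
          rw [norm_mul, norm_pow]
          gcongr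
          refine (norm_add_le _ _).trans ?_
          rw [norm_one]; linarith
      _ = 3 * (‖w - w'‖ ^ 2 / ‖w'‖) := by rw [hnz]; field_simp; ring
  · calc _ ≤ ‖Complex.log (1 + z)‖ := Complex.abs_re_le_norm _
      _ = ‖(Complex.log (1 + z) - z) + z‖ := by rw [sub_add_cancel]
      _ ≤ ‖z‖ ^ 2 + ‖z‖ := (norm_add_le _ _).trans (by gcongr)
      _ ≤ 2 * ‖z‖ := by nlinarith [norm_nonneg z]
      _ = _ := by rw [hnz]

end ComplexLog

section Jets

open Asymptotics

variable {X : Type*} {l : Filter X} {d s f g : X → ℝ} {a b c e a' b' c' e' : ℝ}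

/-- `f = a + b d + c d² + e s² + O(s³)` along `l`. -/
def HasJet (l : Filter X) (d s f : X → ℝ) (a b c e : ℝ) : Prop :=
  (fun x => f x - (a + b * d x + c * d x ^ 2 + e * s x ^ 2)) =O[l] fun x => s x ^ 3

namespace HasJet

lemma of_eq (hf : HasJet l d s f a b c e) (hfg : ∀ᶠ x in l, g x = f x) (ha : a = a')
    (hb : b = b') (hc : c = c') (he : e = e') : HasJet l d s g a' b' c' e' := by
  subst ha hb hc he
  exact hf.congr' (hfg.mono fun x hx => by simp only [hx]) EventuallyEq.rfl

lemma const (a : ℝ) : HasJet l d s (fun _ => a) a 0 0 0 := by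
  simpa [HasJet] using isBigO_zero (fun x => s x ^ 3) l

lemma fst : HasJet l d s d 0 1 0 0 := by
  simpa [HasJet] using isBigO_zero (fun x => s x ^ 3) l

lemma sq_snd : HasJet l d s (fun x => s x ^ 2) 0 0 0 1 := by
  simpa [HasJet] using isBigO_zero (fun x => s x ^ 3) l

lemma add (hf : HasJet l d s f a b c e) (hg : HasJet l d s g a' b' c' e') :
    HasJet l d s (fun x => f x + g x) (a + a') (b + b') (c + c') (e + e') :=
  (IsBigO.add hf hg).congr_left fun x => by ring

lemma const_mul (k : ℝ) (hf : HasJet l d s f a b c e) :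
    HasJet l d s (fun x => k * f x) (k * a) (k * b) (k * c) (k * e) :=
  (IsBigO.const_mul_left hf k).congr_left fun x => by ring

lemma sub (hf : HasJet l d s f a b c e) (hg : HasJet l d s g a' b' c' e') :
    HasJet l d s (fun x => f x - g x) (a - a') (b - b') (c - c') (e - e') :=
  (IsBigO.sub hf hg).congr_left fun x => by ring

lemma isBigO_sq (hd : d =O[l] s) (hs : Tendsto s l (𝓝 0)) (hf : HasJet l d s f 0 0 c e) :
    f =O[l] fun x => s x ^ 2 := by
  have h3 : (fun x => s x ^ 3) =O[l] fun x => s x ^ 2 := by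
    refine ((isBigO_refl (fun x => s x ^ 2) l).mul (hs.isBigO_one ℝ)).congr
      (fun x => ?_) (fun x => ?_) <;> ring
  have h : (fun x => c * d x ^ 2 + e * s x ^ 2) =O[l] fun x => s x ^ 2 :=
    ((hd.pow 2).const_mul_left c).add ((isBigO_refl _ l).const_mul_left e)
  exact ((hf.trans h3).add h).congr_left fun x => by ring

lemma isBigO_self (hd : d =O[l] s) (hs : Tendsto s l (𝓝 0)) (hf : HasJet l d s f 0 b c e) :
    f =O[l] s := by
  have h2 : (fun x => s x ^ 2) =O[l] s := by
    simpa [pow_succ] using (isBigO_refl s l).mul (hs.isBigO_one ℝ)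
  have hf' : HasJet l d s (fun x => f x - b * d x) 0 0 c e :=
    (hf.sub (fst.const_mul b)).of_eq (Eventually.of_forall fun _ => rfl) (by ring) (by ring)
      (by ring) (by ring)
  exact (((isBigO_sq hd hs hf').trans h2).add (hd.const_mul_left b)).congr_left fun x => by ring

lemma isBigO_one (hd : d =O[l] s) (hs : Tendsto s l (𝓝 0)) (hf : HasJet l d s f a b c e) :
    f =O[l] fun _ => (1 : ℝ) := by
  have hf' : HasJet l d s (fun x => f x - a) 0 b c e :=
    (hf.sub (const a)).of_eq (Eventually.of_forall fun _ => rfl) (by ring) (by ring)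
      (by ring) (by ring)
  exact (((isBigO_self hd hs hf').trans (hs.isBigO_one ℝ)).add
    (isBigO_const_const a one_ne_zero l)).congr_left fun x => by ring

lemma mul (hd : d =O[l] s) (hs : Tendsto s l (𝓝 0)) (hf : HasJet l d s f a b c e)
    (hg : HasJet l d s g a' b' c' e') :
    HasJet l d s (fun x => f x * g x) (a * a') (a * b' + b * a') (a * c' + b * b' + c * a')
      (a * e' + e * a') := by
  have hp : HasJet l d s (fun x => a + b * d x + c * d x ^ 2 + e * s x ^ 2) a b c e := by
    simpa [HasJet] using isBigO_zero (fun x => s x ^ 3) l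
  have h1 := IsBigO.mul hf (isBigO_one hd hs hg)
  have h2 := (isBigO_one hd hs hp).mul hg
  have hq : HasJet l d s (fun x => c' * d x ^ 2 + e' * s x ^ 2) 0 0 c' e' := by
    simpa [HasJet] using isBigO_zero (fun x => s x ^ 3) l
  have hr : HasJet l d s (fun x => b * d x + c * d x ^ 2 + e * s x ^ 2) 0 b c e := by
    simpa [HasJet] using isBigO_zero (fun x => s x ^ 3) l
  have hr' : HasJet l d s (fun x => c * d x ^ 2 + e * s x ^ 2) 0 0 c e := by
    simpa [HasJet] using isBigO_zero (fun x => s x ^ 3) l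
  have h3 := (isBigO_self hd hs hr).mul (isBigO_sq hd hs hq)
  have h4 := (isBigO_sq hd hs hr').mul (hd.const_mul_left b')
  have e3 : (fun x => s x * s x ^ 2) = fun x => s x ^ 3 := by ext; ring
  have e4 : (fun x => s x ^ 2 * s x) = fun x => s x ^ 3 := by ext; ring
  rw [e3] at h3
  rw [e4] at h4
  simp only [one_mul, mul_one] at h1 h2
  exact (((h1.add h2).add h3).add h4).congr_left fun x => by ring

lemma tendsto (hd : d =O[l] s) (hs : Tendsto s l (𝓝 0)) (hf : HasJet l d s f a b c e) :
    Tendsto f l (𝓝 a) := by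
  have hf' : HasJet l d s (fun x => f x - a) 0 b c e :=
    (hf.sub (const a)).of_eq (Eventually.of_forall fun _ => rfl) (by ring) (by ring)
      (by ring) (by ring)
  simpa using ((isBigO_self hd hs hf').trans_tendsto hs).add_const a

/-- Composition with a function having a second-order expansion at `1`. -/
lemma comp_of_abs_le {φ : ℝ → ℝ} {p₀ p₁ p₂ : ℝ} (hd : d =O[l] s) (hs : Tendsto s l (𝓝 0))
    (hφ : ∃ K, ∀ᶠ y in 𝓝 (1 : ℝ),
      |φ y - (p₀ + p₁ * (y - 1) + p₂ * (y - 1) ^ 2)| ≤ K * |(y - 1) ^ 3|)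
    (hf : HasJet l d s f 1 b c e) :
    HasJet l d s (fun x => φ (f x)) p₀ (p₁ * b) (p₁ * c + p₂ * b ^ 2) (p₁ * e) := by
  have hf' : HasJet l d s (fun x => f x - 1) 0 b c e :=
    (hf.sub (const 1)).of_eq (Eventually.of_forall fun _ => rfl) (by ring) (by ring)
      (by ring) (by ring)
  obtain ⟨K, hK⟩ := hφ
  have h1 : (fun x => φ (f x) - (p₀ + p₁ * (f x - 1) + p₂ * (f x - 1) ^ 2)) =O[l]
      fun x => s x ^ 3 :=
    (IsBigO.of_bound K ((tendsto hd hs hf).eventually hK)).trans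
      ((isBigO_self hd hs hf').pow 3)
  have h2 := ((const p₀).add (hf'.const_mul p₁)).add ((mul hd hs hf' hf').const_mul p₂)
  refine (IsBigO.add h1 h2).congr_left fun x => ?_
  ring

lemma sqrt (hd : d =O[l] s) (hs : Tendsto s l (𝓝 0)) (hf : HasJet l d s f 1 b c e) :
    HasJet l d s (fun x => √(f x)) 1 (1 / 2 * b) (1 / 2 * c + -(1 / 8) * b ^ 2) (1 / 2 * e) := by
  refine comp_of_abs_le hd hs ⟨1, ?_⟩ hf
  filter_upwards [Icc_mem_nhds (by norm_num : (0 : ℝ) < 1) (by norm_num : (1 : ℝ) < 4)] with y hy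
  have h0 := Real.sqrt_nonneg y
  have h2 : √y ≤ 2 := Real.sqrt_le_iff.2 ⟨by norm_num, by linarith [hy.2]⟩
  have hy' : y = √y ^ 2 := (Real.sq_sqrt hy.1).symm
  generalize √y = r at *
  subst hy'
  have e1 : r - (1 + 1 / 2 * (r ^ 2 - 1) + -(1 / 8) * (r ^ 2 - 1) ^ 2) =
      (r - 1) ^ 3 * ((r + 3) / 8) := by ring
  have e2 : (r ^ 2 - 1) ^ 3 = (r - 1) ^ 3 * (r + 1) ^ 3 := by ring
  have h3 : 1 ≤ (r + 1) ^ 3 := one_le_pow₀ (by linarith)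
  rw [e1, e2, abs_mul, abs_mul, one_mul, abs_of_nonneg (by positivity : 0 ≤ (r + 3) / 8),
    abs_of_nonneg (by positivity : 0 ≤ (r + 1) ^ 3)]
  gcongr
  linarith

lemma inv (hd : d =O[l] s) (hs : Tendsto s l (𝓝 0)) (hf : HasJet l d s f 1 b c e) :
    HasJet l d s (fun x => (f x)⁻¹) 1 (-1 * b) (-1 * c + 1 * b ^ 2) (-1 * e) := by
  refine comp_of_abs_le hd hs ⟨2, ?_⟩ hf
  filter_upwards [Ioi_mem_nhds (by norm_num : (1 / 2 : ℝ) < 1)] with y hy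
  have hy : 1 / 2 < y := hy
  have hy0 : 0 < y := by linarith
  have e1 : y⁻¹ - (1 + -1 * (y - 1) + 1 * (y - 1) ^ 2) = -(y⁻¹ * (y - 1) ^ 3) := by
    field_simp; ring
  rw [e1, abs_neg, abs_mul, abs_of_pos (inv_pos.2 hy0)]
  gcongr
  rw [inv_le_comm₀ hy0 (by norm_num)]; linarith

lemma log (hd : d =O[l] s) (hs : Tendsto s l (𝓝 0)) (hf : HasJet l d s f 1 b c e) :
    HasJet l d s (fun x => Real.log (f x)) 0 (1 * b) (1 * c + -(1 / 2) * b ^ 2) (1 * e) := by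
  refine comp_of_abs_le hd hs ⟨2, ?_⟩ hf
  filter_upwards [Ioo_mem_nhds (by norm_num : (1 / 2 : ℝ) < 1) (by norm_num : (1 : ℝ) < 3 / 2)]
    with y hy
  have hx : |1 - y| < 1 / 2 := abs_lt.2 ⟨by linarith [hy.2], by linarith [hy.1]⟩
  have h := Real.abs_log_sub_add_sum_range_le (x := 1 - y) (by linarith) 2
  simp only [Finset.sum_range_succ, Finset.sum_range_zero, sub_sub_cancel] at h
  have e1 : Real.log y - (0 + 1 * (y - 1) + -(1 / 2) * (y - 1) ^ 2) =
      0 + (1 - y) ^ (0 + 1) / ((0 : ℕ) + 1 : ℝ) + (1 - y) ^ (1 + 1) / ((1 : ℕ) + 1 : ℝ)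
        + Real.log y := by
    push_cast; ring
  rw [e1, abs_pow, abs_sub_comm y 1]
  refine h.trans ?_
  rw [div_le_iff₀ (by linarith)]
  have : 0 ≤ |1 - y| ^ 3 := by positivity
  norm_num
  nlinarith

end HasJet

end Jets

section Expansion

open Asymptotics

/-- The elementary approximation of the scaled action integral. -/
noncomputable def scaledAction (α β : ℝ) : ℝ :=
  mainPrimitive α β 1 - mainPrimitive α β β -
    (1 / 12 + (α - β) / 2 * (3 / 2 - 2 * Real.log 2)
      - (α + β) ^ 2 / 8 * (Real.log 2 - 1 / 2))

/-- Half the angle of the point `focusPoint α β`. -/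
noncomputable def focusAngle (α β : ℝ) : ℝ :=
  Real.arctan (√β * √(1 + α) / (√α * √(1 - β)))

/-- The square of `√(α (1 - β)) + i √(β (1 + α))`, which has modulus `α + β`. -/
noncomputable def focusPoint (α β : ℝ) : ℂ :=
  ⟨α - β - 2 * (α * β), 2 * (√α * √β) * √((1 + α) * (1 - β))⟩

/-- The approximation of the action, without its remainder, in terms of `h` and `y = |j₂|`. -/
noncomputable def actionExpansion (h y : ℝ) : ℝ :=
  4 / 3 - Real.pi * y + y * Real.arctan (y / h)
    + (h - (3 * h ^ 2 + y ^ 2) / 8) * Real.log (16 / √(h ^ 2 + y ^ 2))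
    + h + (17 * h ^ 2 + 3 * y ^ 2) / 16

lemma focusPoint_eq {α β : ℝ} (hα : 0 < α) (hβ : 0 ≤ β) (hβ1 : β < 1) :
    focusPoint α β = ((α + β : ℝ) : ℂ) *
      (Complex.cos ((2 * focusAngle α β : ℝ) : ℂ)
        + Complex.sin ((2 * focusAngle α β : ℝ) : ℂ) * Complex.I) := by
  have hσ : 0 < α + β := by linarith
  have h1 : 0 < 1 - β := by linarith
  have ha := Real.sqrt_pos.2 hα
  have hb := Real.sqrt_pos.2 h1
  have e1 := Real.sq_sqrt hα.le
  have e2 := Real.sq_sqrt h1.le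
  have e3 := Real.sq_sqrt hβ
  have e4 := Real.sq_sqrt (by linarith : 0 ≤ 1 + α)
  have hden : 0 < √α * √(1 - β) := by positivity
  have hcos : Real.cos (focusAngle α β) ^ 2 = α * (1 - β) / (α + β) := by
    rw [focusAngle, Real.cos_sq_arctan, div_pow, mul_pow, mul_pow, e1, e2, e3, e4]
    have : α * (1 - β) + β * (1 + α) = α + β := by ring
    field_simp
    rw [this]
  have hsin : Real.sin (focusAngle α β) =
      √β * √(1 + α) / (√α * √(1 - β)) * Real.cos (focusAngle α β) := by
    have hc := (Real.cos_arctan_pos (√β * √(1 + α) / (√α * √(1 - β)))).ne'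
    have ht := Real.tan_arctan (√β * √(1 + α) / (√α * √(1 - β)))
    rw [Real.tan_eq_sin_div_cos, div_eq_iff hc] at ht
    exact ht
  rw [← Complex.ofReal_cos, ← Complex.ofReal_sin]
  apply Complex.ext
  · simp only [focusPoint, Complex.re_ofReal_mul, Complex.add_re, Complex.ofReal_re,
      Complex.mul_I_re, Complex.ofReal_im, Real.cos_two_mul, hcos]
    field_simp
    ring
  · simp only [focusPoint, Complex.im_ofReal_mul, Complex.add_im, Complex.ofReal_re,
      Complex.mul_I_im, Complex.ofReal_im, Real.sin_two_mul]
    have : 2 * Real.sin (focusAngle α β) * Real.cos (focusAngle α β) =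
        2 * (√β * √(1 + α) / (√α * √(1 - β))) * Real.cos (focusAngle α β) ^ 2 := by
      rw [hsin]; ring
    rw [this, hcos, Real.sqrt_mul (by linarith), zero_add]
    field_simp
    rw [e1, e2]
    ring

lemma focusAngle_nonneg (α β : ℝ) : 0 ≤ focusAngle α β := by
  rw [focusAngle, Real.arctan_nonneg]
  positivity

lemma focusAngle_lt (α β : ℝ) : focusAngle α β < Real.pi / 2 := Real.arctan_lt_pi_div_two _

lemma arg_focusPoint {α β : ℝ} (hα : 0 < α) (hβ : 0 ≤ β) (hβ1 : β < 1) :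
    (focusPoint α β).arg = 2 * focusAngle α β := by
  rw [focusPoint_eq hα hβ hβ1]
  refine Complex.arg_mul_cos_add_sin_mul_I (by linarith) ⟨?_, ?_⟩
  · linarith [focusAngle_nonneg α β, Real.pi_pos]
  · linarith [focusAngle_lt α β]

lemma norm_focusPoint {α β : ℝ} (hα : 0 < α) (hβ : 0 ≤ β) (hβ1 : β < 1) :
    ‖focusPoint α β‖ = α + β := by
  rw [focusPoint_eq hα hβ hβ1, norm_mul, Complex.norm_cos_add_sin_mul_I, Complex.norm_real,
    mul_one, Real.norm_of_nonneg (by linarith)]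

lemma scaledAction_eq {α β : ℝ} (hα : 0 < α) (hβ : 0 ≤ β) (hβ1 : β < 1) :
    scaledAction α β =
      √((1 + α) * (1 - β)) * (6 - (α - β)) / 8
      + ((α - β) / 2 + (α + β) ^ 2 / 16) *
        (Real.log ((2 + (α - β) + 2 * √((1 + α) * (1 - β))) / 4) + 2 * Real.log 2
          - Real.log (α + β))
      - 2 * (√α * √β) * (Real.pi / 2 - focusAngle α β) - 1 / 12
      - (α - β) / 2 * (3 / 2 - 2 * Real.log 2) + (α + β) ^ 2 / 8 * (Real.log 2 - 1 / 2) := by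
  have h1 : 0 < 1 - β := by linarith
  have h2 : 0 < 1 + α := by linarith
  have hX := Real.sqrt_pos.2 h2
  have hY := Real.sqrt_pos.2 h1
  have hlog : Real.log (√(1 + α) + √(1 - β)) =
      (Real.log ((2 + (α - β) + 2 * √((1 + α) * (1 - β))) / 4) + 2 * Real.log 2) / 2 := by
    have e : (2 + (α - β) + 2 * √((1 + α) * (1 - β))) / 4 = ((√(1 + α) + √(1 - β)) / 2) ^ 2 := by
      rw [Real.sqrt_mul h2.le, div_pow, add_sq, Real.sq_sqrt h2.le, Real.sq_sqrt h1.le]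
      ring
    rw [e, Real.log_pow, Real.log_div (by positivity) (by norm_num)]
    push_cast
    ring
  have harctan : √α * √β * Real.arctan (√α * √(1 - β) / (√β * √(1 + α))) =
      √α * √β * (Real.pi / 2 - focusAngle α β) := by
    rcases hβ.eq_or_lt with rfl | hβ
    · simp
    have ha := Real.sqrt_pos.2 hα
    have hb := Real.sqrt_pos.2 hβ
    rw [focusAngle, ← Real.arctan_inv_of_pos (by positivity), inv_div]
  rw [scaledAction, mainPrimitive_self (by linarith), mainPrimitive, hlog, harctan,
    Real.sqrt_mul h2.le]
  ring

/-- The difference between the two approximations, organised by order of magnitude. -/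
lemma scaledAction_sub_actionExpansion {α β C h y : ℝ} (hα : 0 < α) (hβ : 0 ≤ β) (hβ1 : β < 1)
    (hh : 0 < h) (hy : y = 2 * C * (√α * √β)) :
    2 * C * scaledAction α β - actionExpansion h y =
      (C * (√((1 + α) * (1 - β)) * (6 - (α - β)) / 4
          + (α - β + (α + β) ^ 2 / 8) *
            Real.log ((2 + (α - β) + 2 * √((1 + α) * (1 - β))) / 4)
          - 1 / 6 - 3 / 2 * (α - β) - (α + β) ^ 2 / 8)
        - 4 / 3 - (17 * h ^ 2 + 3 * y ^ 2) / 16 - (α - β) + 2 * (α * β))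
      + (C * (α - β + (α + β) ^ 2 / 8) - (h - (3 * h ^ 2 + y ^ 2) / 8)) *
        (4 * Real.log 2 - Real.log (α + β))
      + (-((3 * h ^ 2 + y ^ 2) / 8)) *
        (Real.log ‖(⟨h, y⟩ : ℂ)‖ - Real.log ‖focusPoint α β‖)
      + (h * (Real.log ‖(⟨h, y⟩ : ℂ)‖ - Real.log ‖focusPoint α β‖)
        - y * ((⟨h, y⟩ : ℂ).arg - (focusPoint α β).arg)
        - ((⟨h, y⟩ : ℂ) - focusPoint α β).re) := by
  have hpos : 0 < √(h ^ 2 + y ^ 2) := Real.sqrt_pos.2 (by positivity)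
  have hnorm : ‖(⟨h, y⟩ : ℂ)‖ = √(h ^ 2 + y ^ 2) := by
    rw [Complex.norm_def, Complex.normSq_mk]; ring_nf
  have hlog : Real.log (16 / √(h ^ 2 + y ^ 2)) =
      4 * Real.log 2 - Real.log √(h ^ 2 + y ^ 2) := by
    rw [Real.log_div (by norm_num) hpos.ne', (by norm_num : (16 : ℝ) = 2 ^ 4), Real.log_pow]
    norm_num
  rw [actionExpansion, scaledAction_eq hα hβ hβ1, hnorm, arg_focusPoint hα hβ hβ1,
    norm_focusPoint hα hβ hβ1, arg_mk_of_pos hh, hlog, Complex.sub_re]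
  simp only [focusPoint]
  generalize Real.log √(h ^ 2 + y ^ 2) = L
  generalize Real.arctan (y / h) = φ
  have hy' : 2 * C * (2 * (√α * √β) * (Real.pi / 2 - focusAngle α β)) =
      2 * y * (Real.pi / 2 - focusAngle α β) := by rw [hy]; ring
  linear_combination (-1 : ℝ) * hy'

variable {X : Type*} {l : Filter X} {α β c h y : X → ℝ}

lemma scaledAction_sub_actionExpansion_isBigO
    (hα : ∀ᶠ x in l, 0 < α x) (hβ : ∀ᶠ x in l, 0 ≤ β x)
    (hs : Tendsto (fun x => α x + β x) l (𝓝 0))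
    (hc : ∀ᶠ x in l, c x = (1 - (α x - β x))⁻¹)
    (hh : ∀ᶠ x in l, 0 < h x)
    (hhe : ∀ᶠ x in l, h x = c x ^ 2 * (α x - β x + α x * β x))
    (hye : ∀ᶠ x in l, y x = 2 * (c x * √(c x)) * (√(α x) * √(β x))) :
    (fun x => 2 * (c x * √(c x)) * scaledAction (α x) (β x) - actionExpansion (h x) (y x)) =O[l]
      fun x => (α x + β x) ^ 2 * √(α x + β x) := by
  set d : X → ℝ := fun x => α x - β x with hd_def
  set s : X → ℝ := fun x => α x + β x with hs_def
  have hd : d =O[l] s := by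
    refine IsBigO.of_bound 1 ?_
    filter_upwards [hα, hβ] with x h1 h2
    rw [Real.norm_eq_abs, Real.norm_eq_abs, one_mul, abs_of_nonneg (a := s x) (by positivity),
      abs_le]
    constructor <;> simp only [hd_def, hs_def] <;> linarith
  have hs1 : ∀ᶠ x in l, s x < 1 := hs.eventually (Iio_mem_nhds one_pos)
  have hspos : ∀ᶠ x in l, 0 < s x := by
    filter_upwards [hα, hβ] with x h1 h2
    exact add_pos_of_pos_of_nonneg h1 h2
  have jd : HasJet l d s d 0 1 0 0 := HasJet.fst
  have js : HasJet l d s (fun x => s x ^ 2) 0 0 0 1 := HasJet.sq_snd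
  have jc : HasJet l d s c 1 1 1 0 :=
    (((HasJet.const 1).sub jd).of_eq (g := fun x => 1 - d x) (Eventually.of_forall fun _ => rfl)
      (sub_zero 1) rfl rfl rfl |>.inv hd hs).of_eq hc rfl (by norm_num) (by norm_num)
      (by norm_num)
  have jC : HasJet l d s (fun x => c x * √(c x)) 1 (3 / 2) (15 / 8) 0 :=
    (jc.mul hd hs (jc.sqrt hd hs)).of_eq (Eventually.of_forall fun _ => rfl) (by norm_num)
      (by norm_num) (by norm_num) (by norm_num)
  have jp : HasJet l d s (fun x => α x * β x) 0 0 (-1 / 4) (1 / 4) :=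
    ((js.sub (jd.mul hd hs jd)).const_mul (1 / 4)).of_eq
      (Eventually.of_forall fun x => by simp only [hd_def, hs_def]; ring) (by norm_num)
      (by norm_num) (by norm_num) (by norm_num)
  have jQ : HasJet l d s (fun x => √((1 + α x) * (1 - β x))) 1 (1 / 2) 0 (-1 / 8) := by
    have : HasJet l d s (fun x => (1 + α x) * (1 - β x)) 1 1 (1 / 4) (-1 / 4) :=
      (((HasJet.const 1).add jd).sub jp).of_eq
        (Eventually.of_forall fun x => by simp only [hd_def]; ring) (by norm_num)
        (by norm_num) (by norm_num) (by norm_num)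
    exact (this.sqrt hd hs).of_eq (Eventually.of_forall fun _ => rfl) rfl (by norm_num)
      (by norm_num) (by norm_num)
  have jL : HasJet l d s
      (fun x => Real.log ((2 + d x + 2 * √((1 + α x) * (1 - β x))) / 4)) 0 (1 / 2)
        (-1 / 8) (-1 / 16) := by
    have : HasJet l d s (fun x => (2 + d x + 2 * √((1 + α x) * (1 - β x))) / 4) 1 (1 / 2) 0
        (-1 / 16) :=
      ((((HasJet.const 2).add jd).add (jQ.const_mul 2)).const_mul (1 / 4)).of_eq
        (Eventually.of_forall fun x => by ring) (by norm_num)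
        (by norm_num) (by norm_num) (by norm_num)
    exact (this.log hd hs).of_eq (Eventually.of_forall fun _ => rfl) rfl (by norm_num)
      (by norm_num) (by norm_num)
  have jh : HasJet l d s h 0 1 (7 / 4) (1 / 4) :=
    ((jc.mul hd hs jc).mul hd hs (jd.add jp)).of_eq (hhe.mono fun x hx => by rw [hx]; ring)
      (by norm_num) (by norm_num) (by norm_num) (by norm_num)
  have jy2 : HasJet l d s (fun x => y x ^ 2) 0 0 (-1) 1 := by
    refine (((jC.mul hd hs jC).mul hd hs jp).const_mul 4).of_eq ?_
      (by norm_num) (by norm_num) (by norm_num) (by norm_num)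
    filter_upwards [hye, hα, hβ] with x hx h1 h2
    rw [hx, mul_pow, mul_pow, mul_pow (√(α x)), Real.sq_sqrt h1.le, Real.sq_sqrt h2]
    ring
  have jh2 := jh.mul hd hs jh
  have jB : HasJet l d s (fun x => c x * √(c x) * (d x + s x ^ 2 / 8)) 0 1 (3 / 2) (1 / 8) :=
    (jC.mul hd hs (jd.add (js.const_mul (1 / 8)))).of_eq
      (Eventually.of_forall fun x => by ring) (by norm_num) (by norm_num) (by norm_num)
      (by norm_num)
  have jq : HasJet l d s (fun x => -((3 * h x ^ 2 + y x ^ 2) / 8)) 0 0 (-1 / 4) (-1 / 8) :=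
    (((jh2.const_mul 3).add jy2).const_mul (-1 / 8)).of_eq
      (Eventually.of_forall fun x => by ring) (by norm_num) (by norm_num) (by norm_num)
      (by norm_num)
  have jBG : HasJet l d s (fun x => c x * √(c x) * (d x + s x ^ 2 / 8)
      - (h x - (3 * h x ^ 2 + y x ^ 2) / 8)) 0 0 0 0 :=
    (jB.sub (jh.add jq)).of_eq (Eventually.of_forall fun x => by ring) (by norm_num)
      (by norm_num) (by norm_num) (by norm_num)
  have jA : HasJet l d s (fun x => c x * √(c x) * (√((1 + α x) * (1 - β x)) * (6 - d x) / 4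
          + (d x + s x ^ 2 / 8) * Real.log ((2 + d x + 2 * √((1 + α x) * (1 - β x))) / 4)
          - 1 / 6 - 3 / 2 * d x - s x ^ 2 / 8)
        - 4 / 3 - (17 * h x ^ 2 + 3 * y x ^ 2) / 16 - d x + 2 * (α x * β x)) 0 0 0 0 := by
    have j1 := (jQ.mul hd hs ((HasJet.const 6).sub jd)).const_mul (1 / 4)
    have j2 := (jd.add (js.const_mul (1 / 8))).mul hd hs jL
    have j3 := (((j1.add j2).sub (HasJet.const (1 / 6))).sub (jd.const_mul (3 / 2))).sub
      (js.const_mul (1 / 8))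
    have j4 := (jh2.const_mul (17 / 16)).add (jy2.const_mul (3 / 16))
    refine (((((jC.mul hd hs j3).sub (HasJet.const (4 / 3))).sub j4).sub jd).add
      (jp.const_mul 2)).of_eq (Eventually.of_forall fun x => by ring) ?_ ?_ ?_ ?_ <;> norm_num
  have jre : HasJet l d s (fun x => ((⟨h x, y x⟩ : ℂ) - focusPoint (α x) (β x)).re) 0 0
      (5 / 4) (3 / 4) :=
    ((jh.sub jd).add (jp.const_mul 2)).of_eq (Eventually.of_forall fun x => by
      simp only [focusPoint, Complex.sub_re, hd_def]; ring) (by norm_num) (by norm_num)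
      (by norm_num) (by norm_num)
  have him : (fun x => ((⟨h x, y x⟩ : ℂ) - focusPoint (α x) (β x)).im) =O[l]
      fun x => s x ^ 2 := by
    have h1 : (fun x => √(α x) * √(β x)) =O[l] s := by
      refine IsBigO.of_bound 1 ?_
      filter_upwards [hα, hβ] with x h1 h2
      have hx : √(α x) ≤ √(s x) := Real.sqrt_le_sqrt (by simp only [hs_def]; linarith)
      have hy : √(β x) ≤ √(s x) := Real.sqrt_le_sqrt (by simp only [hs_def]; linarith)
      rw [Real.norm_of_nonneg (by positivity), one_mul]
      calc _ ≤ √(s x) * √(s x) := by gcongr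
        _ = s x := Real.mul_self_sqrt (by positivity)
        _ ≤ _ := le_abs_self _
    have h2 : HasJet l d s (fun x => c x * √(c x) - √((1 + α x) * (1 - β x))) 0 1 (15 / 8)
        (1 / 8) :=
      (jC.sub jQ).of_eq (Eventually.of_forall fun _ => rfl) (by norm_num) (by norm_num)
        (by norm_num) (by norm_num)
    refine ((h1.mul (h2.isBigO_self hd hs)).const_mul_left 2).congr' ?_
      (Eventually.of_forall fun x => by ring)
    filter_upwards [hye] with x hx
    simp only [focusPoint, Complex.sub_im, hx]
    ring
  have hw : (fun x => ‖(⟨h x, y x⟩ : ℂ) - focusPoint (α x) (β x)‖) =O[l] fun x => s x ^ 2 := by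
    refine IsBigO.trans (IsBigO.of_bound 1 (Eventually.of_forall fun x => ?_))
      ((jre.isBigO_sq hd hs).norm_left.add him.norm_left)
    rw [norm_norm, one_mul, Real.norm_of_nonneg (by positivity)]
    exact Complex.norm_le_abs_re_add_abs_im _
  have hsmall : ∀ᶠ x in l,
      ‖(⟨h x, y x⟩ : ℂ) - focusPoint (α x) (β x)‖ ≤ ‖focusPoint (α x) (β x)‖ / 2 := by
    have hlo : (fun x => ‖(⟨h x, y x⟩ : ℂ) - focusPoint (α x) (β x)‖) =o[l] s := by
      refine hw.trans_isLittleO ?_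
      simpa [sq] using (isBigO_refl s l).mul_isLittleO ((isLittleO_one_iff ℝ).2 hs)
    filter_upwards [hlo.bound (by norm_num : (0 : ℝ) < 1 / 2), hα, hβ, hs1, hspos]
      with x hx h1 h2 h3 h4
    rw [norm_focusPoint h1 h2 (by simp only [hs_def] at h3; linarith)]
    rw [norm_norm, Real.norm_of_nonneg h4.le] at hx
    simp only [hs_def] at hx
    linarith
  have hlogs : ∀ᶠ x in l,
      |h x * (Real.log ‖(⟨h x, y x⟩ : ℂ)‖ - Real.log ‖focusPoint (α x) (β x)‖)
        - y x * ((⟨h x, y x⟩ : ℂ).arg - (focusPoint (α x) (β x)).arg)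
        - ((⟨h x, y x⟩ : ℂ) - focusPoint (α x) (β x)).re| ≤
        3 * (‖(⟨h x, y x⟩ : ℂ) - focusPoint (α x) (β x)‖ ^ 2 / s x) ∧
      |Real.log ‖(⟨h x, y x⟩ : ℂ)‖ - Real.log ‖focusPoint (α x) (β x)‖| ≤
        2 * (‖(⟨h x, y x⟩ : ℂ) - focusPoint (α x) (β x)‖ / s x) := by
    filter_upwards [hsmall, hα, hβ, hs1, hspos, hh, hye, hc] with x hx h1 h2 h3 h4 h5 h6 h7
    have hβ1 : β x < 1 := by simp only [hs_def] at h3; linarith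
    have hn := norm_focusPoint h1 h2 hβ1
    have ha := arg_focusPoint h1 h2 hβ1
    have hy0 : 0 ≤ y x := by
      have : 0 ≤ c x := by
        rw [h7]; simp only [hs_def] at h3; exact inv_nonneg.2 (by linarith)
      rw [h6]; positivity
    have hw0 : (⟨h x, y x⟩ : ℂ) ≠ 0 := fun h0 => h5.ne' (congrArg Complex.re h0)
    have hw1 : focusPoint (α x) (β x) ≠ 0 := norm_pos_iff.1 (by rw [hn]; exact h4)
    have hg0 := focusAngle_nonneg (α x) (β x)
    have hg1 := focusAngle_lt (α x) (β x)
    have harg : (⟨h x, y x⟩ : ℂ).arg = Real.arctan (y x / h x) := arg_mk_of_pos h5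
    have harg0 : 0 ≤ Real.arctan (y x / h x) := Real.arctan_nonneg.2 (by positivity)
    have harg1 := Real.arctan_lt_pi_div_two (y x / h x)
    have := abs_re_mul_log_sub_le hw0 hw1
      (by rw [harg, ha, abs_lt]; constructor <;> linarith [Real.pi_pos])
      (by rw [ha]; linarith) hx
    rwa [show s x = ‖focusPoint (α x) (β x)‖ from hn.symm]
  have hO3 : (fun x => s x ^ 3) =O[l] fun x => s x ^ 2 * √(s x) := by
    refine IsBigO.of_bound 1 ?_
    filter_upwards [hspos, hs1] with x h1 h2
    rw [Real.norm_of_nonneg (by positivity), Real.norm_of_nonneg (by positivity), one_mul,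
      pow_succ]
    gcongr
    exact Real.le_sqrt_of_sq_le (by nlinarith)
  have hquot : ∀ n : ℕ, (fun x => s x ^ (n + 1) / s x) =O[l] fun x => s x ^ n := by
    intro n
    refine IsBigO.of_bound 1 ?_
    filter_upwards [hspos] with x h1
    rw [one_mul, pow_succ, mul_div_cancel_right₀ _ h1.ne']
  have hlogdiff : (fun x => Real.log ‖(⟨h x, y x⟩ : ℂ)‖ - Real.log ‖focusPoint (α x) (β x)‖)
      =O[l] s := by
    have h1 : (fun x => 2 * (‖(⟨h x, y x⟩ : ℂ) - focusPoint (α x) (β x)‖ / s x)) =O[l] s := by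
      refine IsBigO.const_mul_left ?_ 2
      refine (hw.mul (isBigO_refl (fun x => (s x)⁻¹) l)).trans ?_
      simpa [div_eq_mul_inv] using hquot 1
    refine IsBigO.trans (IsBigO.of_bound 1 ?_) h1
    filter_upwards [hlogs] with x hx
    rw [one_mul]
    exact hx.2.trans (le_abs_self _)
  have hlast : (fun x => h x * (Real.log ‖(⟨h x, y x⟩ : ℂ)‖
        - Real.log ‖focusPoint (α x) (β x)‖)
        - y x * ((⟨h x, y x⟩ : ℂ).arg - (focusPoint (α x) (β x)).arg)
        - ((⟨h x, y x⟩ : ℂ) - focusPoint (α x) (β x)).re) =O[l] fun x => s x ^ 3 := by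
    have h1 : (fun x => 3 * (‖(⟨h x, y x⟩ : ℂ) - focusPoint (α x) (β x)‖ ^ 2 / s x)) =O[l]
        fun x => s x ^ 3 := by
      refine IsBigO.const_mul_left ?_ 3
      refine ((hw.pow 2).mul (isBigO_refl (fun x => (s x)⁻¹) l)).trans ?_
      simpa [div_eq_mul_inv, ← pow_mul] using hquot 3
    refine IsBigO.trans (IsBigO.of_bound 1 ?_) h1
    filter_upwards [hlogs] with x hx
    rw [one_mul]
    exact hx.1.trans (le_abs_self _)
  have hlogO : (fun x => s x ^ 3 * (4 * Real.log 2 - Real.log (s x))) =O[l]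
      fun x => s x ^ 2 * √(s x) := by
    refine IsBigO.of_bound (4 * Real.log 2 + 2) ?_
    filter_upwards [hspos, hs1] with x h1 h2
    have hr := Real.sqrt_pos.2 h1
    have hr1 : √(s x) ≤ 1 := Real.sqrt_le_one.2 h2.le
    have hb := Real.abs_log_mul_self_lt (√(s x)) hr hr1
    have hl2 : 0 < Real.log 2 := Real.log_pos (by norm_num)
    have hb' : |√(s x) * (4 * Real.log 2 - Real.log (s x))| ≤ 4 * Real.log 2 + 2 := by
      rw [Real.log_sqrt h1.le] at hb
      have := abs_lt.1 hb
      rw [abs_le]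
      constructor <;> nlinarith
    have hsq : s x ^ 3 * (4 * Real.log 2 - Real.log (s x)) =
        √(s x) * (4 * Real.log 2 - Real.log (s x)) * (s x ^ 2 * √(s x)) := by
      have := Real.mul_self_sqrt h1.le
      linear_combination (-(s x ^ 2) * (4 * Real.log 2 - Real.log (s x))) * this
    rw [hsq, norm_mul]
    gcongr
    exact hb'
  have hBG3 : (fun x => c x * √(c x) * (d x + s x ^ 2 / 8)
      - (h x - (3 * h x ^ 2 + y x ^ 2) / 8)) =O[l] fun x => s x ^ 3 := by
    simpa [HasJet] using jBG
  have hA3 : (fun x => c x * √(c x) * (√((1 + α x) * (1 - β x)) * (6 - d x) / 4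
          + (d x + s x ^ 2 / 8) * Real.log ((2 + d x + 2 * √((1 + α x) * (1 - β x))) / 4)
          - 1 / 6 - 3 / 2 * d x - s x ^ 2 / 8)
        - 4 / 3 - (17 * h x ^ 2 + 3 * y x ^ 2) / 16 - d x + 2 * (α x * β x)) =O[l]
        fun x => s x ^ 3 := by
    simpa [HasJet] using jA
  have hmid : (fun x => -((3 * h x ^ 2 + y x ^ 2) / 8) *
      (Real.log ‖(⟨h x, y x⟩ : ℂ)‖ - Real.log ‖focusPoint (α x) (β x)‖)) =O[l]
      fun x => s x ^ 3 :=
    ((jq.isBigO_sq hd hs).mul hlogdiff).congr_right fun x => by ring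
  refine ((((hA3.trans hO3).add ((hBG3.mul (isBigO_refl
    (fun x => 4 * Real.log 2 - Real.log (s x)) l)).trans hlogO)).add
    (hmid.trans hO3)).add (hlast.trans hO3)).congr' ?_ EventuallyEq.rfl
  filter_upwards [hα, hβ, hs1, hh, hye] with x h1 h2 h3 h4 h5
  exact (scaledAction_sub_actionExpansion h1 h2 (by simp only [hs_def] at h3; linarith) h4
    h5).symm

end Expansion

section Roots

/-- Distinct roots of the cubic give its factorization. -/
lemma cubic_factor {h k x₁ x₂ x₃ : ℝ} (h₁₂ : x₁ ≠ x₂) (h₁₃ : x₁ ≠ x₃) (h₂₃ : x₂ ≠ x₃)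
    (e₁ : -2 * x₁ ^ 3 + 2 * x₁ ^ 2 + 2 * h * x₁ - k = 0)
    (e₂ : -2 * x₂ ^ 3 + 2 * x₂ ^ 2 + 2 * h * x₂ - k = 0)
    (e₃ : -2 * x₃ ^ 3 + 2 * x₃ ^ 2 + 2 * h * x₃ - k = 0) (z : ℝ) :
    -2 * z ^ 3 + 2 * z ^ 2 + 2 * h * z - k = -2 * (z - x₁) * (z - x₂) * (z - x₃) := by
  have f₁₂ : x₁ ^ 2 + x₁ * x₂ + x₂ ^ 2 - (x₁ + x₂) - h = 0 :=
    mul_left_cancel₀ (sub_ne_zero.2 h₁₂) (by linear_combination (e₂ - e₁) / 2)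
  have f₁₃ : x₁ ^ 2 + x₁ * x₃ + x₃ ^ 2 - (x₁ + x₃) - h = 0 :=
    mul_left_cancel₀ (sub_ne_zero.2 h₁₃) (by linear_combination (e₃ - e₁) / 2)
  have g : x₁ + x₂ + x₃ - 1 = 0 :=
    mul_left_cancel₀ (sub_ne_zero.2 h₂₃) (by linear_combination f₁₂ - f₁₃)
  have hsum : x₃ = 1 - x₁ - x₂ := by linarith
  subst hsum
  have hh : h = x₁ ^ 2 + x₁ * x₂ + x₂ ^ 2 - (x₁ + x₂) := by linarith
  subst hh
  linear_combination e₁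

lemma exists_cubic_roots {h j r : ℝ} (hh : 0 < h) (hr : 0 < r) (hr2 : r ^ 2 = h ^ 2 + j ^ 2)
    (hr4 : r < 1 / 4) :
    ∃ z₁ z₂ z₃ : ℝ, (z₁ < 0 ∧ 0 ≤ z₂ ∧ z₂ < z₃ ∧
      ∀ z : ℝ, -2 * z ^ 3 + 2 * z ^ 2 + 2 * h * z - j ^ 2 / 2 =
        -2 * (z - z₁) * (z - z₂) * (z - z₃)) ∧ -(2 * r) ≤ z₁ ∧ z₂ ≤ 2 * r := by
  set f : ℝ → ℝ := fun z => -2 * z ^ 3 + 2 * z ^ 2 + 2 * h * z - j ^ 2 / 2 with hf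
  have hc : Continuous f := by fun_prop
  have hhr : h ≤ r := abs_le_of_sq_le_sq' (by nlinarith [sq_nonneg j]) hr.le |>.2
  have hj2 : j ^ 2 ≤ r ^ 2 := by nlinarith [sq_nonneg h]
  have hhr2 : h * r ≤ r * r := by gcongr
  have v1 : 0 ≤ f (-(2 * r)) := by
    simp only [hf]; nlinarith [pow_pos hr 3]
  have v2 : f (-(h / 2)) < 0 := by
    simp only [hf]; nlinarith [sq_nonneg j, mul_pos hh hh, mul_pos (mul_pos hh hh) hh]
  have v3 : f 0 ≤ 0 := by simp only [hf]; nlinarith [sq_nonneg j]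
  have v4 : 0 < f (2 * r) := by
    simp only [hf]; nlinarith [mul_pos hr hr, mul_pos hh hr]
  have v5 : f 2 ≤ 0 := by simp only [hf]; nlinarith [sq_nonneg j]
  obtain ⟨z₁, hz₁, e₁⟩ := intermediate_value_Icc' (by linarith : -(2 * r) ≤ -(h / 2))
    hc.continuousOn ⟨v2.le, v1⟩
  obtain ⟨z₂, hz₂, e₂⟩ := intermediate_value_Icc (by linarith : (0 : ℝ) ≤ 2 * r)
    hc.continuousOn ⟨v3, v4.le⟩
  obtain ⟨z₃, hz₃, e₃⟩ := intermediate_value_Icc' (by linarith : 2 * r ≤ 2)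
    hc.continuousOn ⟨v5, v4.le⟩
  have hlt : z₂ < z₃ := by
    refine (hz₂.2.trans hz₃.1).lt_of_ne fun h0 => ?_
    have : z₂ = 2 * r := le_antisymm hz₂.2 (h0 ▸ hz₃.1)
    rw [this] at e₂
    exact v4.ne' e₂
  have hneg : z₁ < 0 := by linarith [hz₁.2]
  exact ⟨z₁, z₂, z₃, ⟨hneg, hz₂.1, hlt, cubic_factor (by linarith [hz₂.1])
    (by linarith [hz₂.1]) hlt.ne e₁ e₂ e₃⟩, hz₁.1, hz₂.2⟩

/-- Vieta's relations for the roots `-c α, c β, c`. -/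
lemma vieta_scaled {h j z₁ z₂ z₃ : ℝ} (h₃ : 0 < z₃)
    (hz : ∀ z : ℝ, -2 * z ^ 3 + 2 * z ^ 2 + 2 * h * z - j ^ 2 / 2 =
      -2 * (z - z₁) * (z - z₂) * (z - z₃)) :
    z₃ * (1 - (-z₁ / z₃ - z₂ / z₃)) = 1 ∧
      h = z₃ ^ 2 * (-z₁ / z₃ - z₂ / z₃ + -z₁ / z₃ * (z₂ / z₃)) ∧
      j ^ 2 = 4 * z₃ ^ 3 * (-z₁ / z₃ * (z₂ / z₃)) := by
  have e0 := hz 0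
  have e1 := hz 1
  have e2 := hz (-1)
  have hsum : z₁ + z₂ + z₃ = 1 := by linarith
  refine ⟨?_, ?_, ?_⟩
  · field_simp; linarith
  · field_simp; linear_combination (e1 - e2) / 4
  · field_simp; linear_combination (-2 : ℝ) * e0

lemma action_eq_scaled {h j z₁ z₂ z₃ : ℝ} (h₂ : 0 ≤ z₂) (h₃ : z₂ < z₃)
    (hz : ∀ z : ℝ, -2 * z ^ 3 + 2 * z ^ 2 + 2 * h * z - j ^ 2 / 2 =
      -2 * (z - z₁) * (z - z₂) * (z - z₃)) :
    √2 * (∫ z in z₂..z₃, √(-2 * z ^ 3 + 2 * z ^ 2 + 2 * h * z - j ^ 2 / 2) / z) =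
      2 * (z₃ * √z₃) *
        ∫ u in (z₂ / z₃)..1, √((u + -z₁ / z₃) * (u - z₂ / z₃) * (1 - u)) / u := by
  have hc : 0 < z₃ := h₂.trans_lt h₃
  have hsub := intervalIntegral.integral_comp_mul_left (a := z₂ / z₃) (b := 1) (fun z =>
    √(-2 * z ^ 3 + 2 * z ^ 2 + 2 * h * z - j ^ 2 / 2) / z) hc.ne'
  rw [mul_div_cancel₀ _ hc.ne', mul_one, smul_eq_mul, eq_inv_mul_iff_mul_eq₀ hc.ne'] at hsub
  rw [← hsub, ← intervalIntegral.integral_const_mul, ← intervalIntegral.integral_const_mul,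
    ← intervalIntegral.integral_const_mul]
  refine intervalIntegral.integral_congr fun u _ => ?_
  have e : -2 * (z₃ * u) ^ 3 + 2 * (z₃ * u) ^ 2 + 2 * h * (z₃ * u) - j ^ 2 / 2 =
      2 * (z₃ ^ 2 * (z₃ * ((u + -z₁ / z₃) * (u - z₂ / z₃) * (1 - u)))) := by
    rw [hz]; field_simp; ring
  rw [e, Real.sqrt_mul (by norm_num), Real.sqrt_mul (by positivity), Real.sqrt_mul hc.le,
    Real.sqrt_sq hc.le]
  have h2 : √2 * √2 = 2 := Real.mul_self_sqrt (by norm_num)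
  rcases eq_or_ne u 0 with rfl | hu
  · simp
  · generalize √((u + -z₁ / z₃) * (u - z₂ / z₃) * (1 - u)) = S
    field_simp
    linear_combination S * h2

end Roots

lemma actionExpansion_abs (h j : ℝ) :
    actionExpansion h |j| = 4 / 3 - Real.pi * |j| + j * Real.arctan (j / h)
      + (h - (3 * h ^ 2 + j ^ 2) / 8) * Real.log (16 / √(h ^ 2 + j ^ 2))
      + h + (17 * h ^ 2 + 3 * j ^ 2) / 16 := by
  have : |j| * Real.arctan (|j| / h) = j * Real.arctan (j / h) := by
    rcases abs_choice j with hj | hj <;> rw [hj]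
    rw [neg_div, Real.arctan_neg, neg_mul_neg]
  rw [actionExpansion, sq_abs, this]

/-- Lemma 2, finite-order version: expansion of the non-trivial action
A(h, j₂) = √2 ∫_{z₂}^{z₃} √(P(z))/z dz of the champagne bottle near the focus-focus
point, with remainder R(h, j₂) = o(h² + j₂²) as (h, j₂) → (0,0) in the half-plane
{h > 0}. -/
theorem champagne_bottle_action_expansion :
    ∃ δ : ℝ, 0 < δ ∧
    ∃ z₁ z₂ z₃ R : ℝ → ℝ → ℝ,
      (∀ h j₂ : ℝ, 0 < h → 0 < h^2 + j₂^2 → h^2 + j₂^2 < δ →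
        z₁ h j₂ < 0 ∧ 0 ≤ z₂ h j₂ ∧ z₂ h j₂ < z₃ h j₂ ∧
        (∀ z : ℝ, -2 * z^3 + 2 * z^2 + 2 * h * z - j₂^2 / 2 =
          -2 * (z - z₁ h j₂) * (z - z₂ h j₂) * (z - z₃ h j₂)) ∧
        Real.sqrt 2 *
          (∫ z in (z₂ h j₂)..(z₃ h j₂),
            Real.sqrt (-2 * z^3 + 2 * z^2 + 2 * h * z - j₂^2 / 2) / z) =
          4/3 - Real.pi * |j₂| + j₂ * Real.arctan (j₂ / h)
          + (h - (3 * h^2 + j₂^2) / 8) * Real.log (16 / Real.sqrt (h^2 + j₂^2))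
          + h + (17 * h^2 + 3 * j₂^2) / 16 + R h j₂) ∧
      Tendsto (fun p : ℝ × ℝ => R p.1 p.2 / (p.1^2 + p.2^2))
        (nhdsWithin (0, 0) {p : ℝ × ℝ | 0 < p.1}) (nhds 0) := by
  have key : ∀ h j : ℝ, ∃ z₁ z₂ z₃ : ℝ, 0 < h → h ^ 2 + j ^ 2 < 1 / 16 →
      (z₁ < 0 ∧ 0 ≤ z₂ ∧ z₂ < z₃ ∧
        ∀ z : ℝ, -2 * z ^ 3 + 2 * z ^ 2 + 2 * h * z - j ^ 2 / 2 =
          -2 * (z - z₁) * (z - z₂) * (z - z₃)) ∧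
      -(2 * √(h ^ 2 + j ^ 2)) ≤ z₁ ∧ z₂ ≤ 2 * √(h ^ 2 + j ^ 2) := by
    intro h j
    by_cases hc : 0 < h ∧ h ^ 2 + j ^ 2 < 1 / 16
    · have hpos : 0 < h ^ 2 + j ^ 2 := add_pos_of_pos_of_nonneg (pow_pos hc.1 2) (sq_nonneg j)
      obtain ⟨z₁, z₂, z₃, hz⟩ := exists_cubic_roots hc.1 (Real.sqrt_pos.2 hpos)
        (Real.sq_sqrt hpos.le) ((Real.sqrt_lt' (by norm_num)).2 (by linarith [hc.2]))
      exact ⟨z₁, z₂, z₃, fun _ _ => hz⟩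
    · exact ⟨0, 0, 0, fun h1 h2 => absurd ⟨h1, h2⟩ hc⟩
  choose z₁ z₂ z₃ hz using key
  refine ⟨1 / 16, by norm_num, z₁, z₂, z₃, fun h j => √2 * (∫ z in (z₂ h j)..(z₃ h j),
    √(-2 * z ^ 3 + 2 * z ^ 2 + 2 * h * z - j ^ 2 / 2) / z) - actionExpansion h |j|, ?_, ?_⟩
  · intro h j hh _ hlt
    obtain ⟨⟨h1, h2, h3, h4⟩, -⟩ := hz h j hh hlt
    refine ⟨h1, h2, h3, h4, ?_⟩
    beta_reduce
    rw [actionExpansion_abs]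
    ring
  set l := nhdsWithin ((0, 0) : ℝ × ℝ) {p : ℝ × ℝ | 0 < p.1}
  set r : ℝ × ℝ → ℝ := fun p => √(p.1 ^ 2 + p.2 ^ 2) with hr
  set α : ℝ × ℝ → ℝ := fun p => -z₁ p.1 p.2 / z₃ p.1 p.2 with hα
  set β : ℝ × ℝ → ℝ := fun p => z₂ p.1 p.2 / z₃ p.1 p.2 with hβ
  set c : ℝ × ℝ → ℝ := fun p => z₃ p.1 p.2 with hc
  have hr2 : ∀ p, r p ^ 2 = p.1 ^ 2 + p.2 ^ 2 := fun p => Real.sq_sqrt (by positivity)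
  have hr0 : ∀ p, 0 ≤ r p := fun p => Real.sqrt_nonneg _
  have hrt : Tendsto r l (𝓝 0) := by
    have : Continuous r := by fun_prop
    simpa [hr] using (this.tendsto (0, 0)).mono_left nhdsWithin_le_nhds
  have hpos : ∀ᶠ p : ℝ × ℝ in l, 0 < p.1 := eventually_mem_nhdsWithin
  have hrlt : ∀ᶠ p in l, r p < 1 / 4 := hrt.eventually (Iio_mem_nhds (by norm_num))
  have hroots : ∀ᶠ p : ℝ × ℝ in l, (z₁ p.1 p.2 < 0 ∧ 0 ≤ z₂ p.1 p.2 ∧ z₂ p.1 p.2 < c p ∧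
        ∀ z : ℝ, -2 * z ^ 3 + 2 * z ^ 2 + 2 * p.1 * z - p.2 ^ 2 / 2 =
          -2 * (z - z₁ p.1 p.2) * (z - z₂ p.1 p.2) * (z - c p)) ∧
      -(2 * r p) ≤ z₁ p.1 p.2 ∧ z₂ p.1 p.2 ≤ 2 * r p := by
    filter_upwards [hpos, hrlt] with p h1 h2
    exact hz p.1 p.2 h1 (by rw [← hr2]; nlinarith [hr0 p])
  have hbasic : ∀ᶠ p in l, 1 / 2 ≤ c p ∧ c p ≤ 2 ∧ 0 < α p ∧ 0 ≤ β p ∧ β p ≤ 1 ∧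
      α p + β p ≤ 8 * r p := by
    filter_upwards [hroots, hrlt] with p ⟨⟨h1, h2, h3, h4⟩, h5, h6⟩ h7
    have hc0 : 0 < c p := h2.trans_lt h3
    have hsum := (vieta_scaled hc0 h4).1
    have hsum' : c p = 1 - z₁ p.1 p.2 - z₂ p.1 p.2 := by
      field_simp at hsum
      linarith
    have hc2 : 1 / 2 ≤ c p := by linarith
    refine ⟨hc2, by linarith, div_pos (by linarith) hc0, div_nonneg h2 hc0.le,
      (div_le_one hc0).2 h3.le, ?_⟩
    simp only [hα, hβ]
    rw [← add_div, div_le_iff₀ hc0]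
    nlinarith [hr0 p]
  have hσt : Tendsto (fun p => α p + β p) l (𝓝 0) := by
    refine squeeze_zero' (g := fun p => 8 * r p) ?_ ?_ (by simpa using hrt.const_mul 8)
    · filter_upwards [hbasic] with p hp
      linarith [hp.2.2.1, hp.2.2.2.1]
    · filter_upwards [hbasic] with p hp using hp.2.2.2.2.2
  have hexp := scaledAction_sub_actionExpansion_isBigO (l := l) (α := α) (β := β) (c := c)
    (h := fun p => p.1) (y := fun p => |p.2|) (hbasic.mono fun p hp => hp.2.2.1)
    (hbasic.mono fun p hp => hp.2.2.2.1) hσt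
    (by
      filter_upwards [hroots] with p ⟨⟨h1, h2, h3, h4⟩, _⟩
      exact eq_inv_of_mul_eq_one_left (vieta_scaled (h2.trans_lt h3) h4).1)
    hpos
    (by
      filter_upwards [hroots] with p ⟨⟨h1, h2, h3, h4⟩, _⟩
      exact (vieta_scaled (h2.trans_lt h3) h4).2.1)
    (by
      filter_upwards [hroots, hbasic] with p ⟨⟨h1, h2, h3, h4⟩, _⟩ ⟨_, _, h5, h6, _⟩
      have hc0 : 0 < c p := h2.trans_lt h3
      have hj := (vieta_scaled hc0 h4).2.2
      rw [← abs_of_nonneg (by positivity : 0 ≤ 2 * (c p * √(c p)) * (√(α p) * √(β p))),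
        ← sq_eq_sq_iff_abs_eq_abs, hj, mul_pow, mul_pow, mul_pow, mul_pow (√(α p)),
        Real.sq_sqrt hc0.le, Real.sq_sqrt h5.le, Real.sq_sqrt h6]
      ring)
  have hint : (fun p : ℝ × ℝ => √2 * (∫ z in (z₂ p.1 p.2)..(c p),
      √(-2 * z ^ 3 + 2 * z ^ 2 + 2 * p.1 * z - p.2 ^ 2 / 2) / z)
      - 2 * (c p * √(c p)) * scaledAction (α p) (β p)) =O[l]
      fun p => (α p + β p) ^ 2 * √(α p + β p) := by
    refine Asymptotics.IsBigO.of_bound 32 ?_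
    filter_upwards [hroots, hbasic] with p ⟨⟨h1, h2, h3, h4⟩, _⟩ ⟨h5, h6, h7, h8, h9, _⟩
    have hC : 2 * (c p * √(c p)) ≤ 8 := by
      have : √(c p) ≤ 2 := Real.sqrt_le_iff.2 ⟨by norm_num, by linarith⟩
      nlinarith [Real.sqrt_nonneg (c p)]
    have hC0 : 0 ≤ 2 * (c p * √(c p)) := by
      have : 0 ≤ c p := by linarith
      positivity
    rw [action_eq_scaled h2 h3 h4, ← mul_sub, norm_mul, Real.norm_of_nonneg hC0,
      Real.norm_of_nonneg (by positivity : 0 ≤ (α p + β p) ^ 2 * √(α p + β p))]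
    exact (mul_le_mul hC (abs_integral_sub_mainPrimitive_le h7 h8 h9) (abs_nonneg _)
      (by norm_num)).trans (le_of_eq (by ring))
  have hσr : (fun p => (α p + β p) ^ 2 * √(α p + β p)) =o[l] fun p => p.1 ^ 2 + p.2 ^ 2 := by
    have h1 : (fun p => (α p + β p) ^ 2) =O[l] fun p => p.1 ^ 2 + p.2 ^ 2 := by
      refine Asymptotics.IsBigO.of_bound 64 ?_
      filter_upwards [hbasic] with p ⟨_, _, h7, h8, _, h9⟩
      rw [← hr2, Real.norm_of_nonneg (by positivity), Real.norm_of_nonneg (by positivity)]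
      nlinarith
    have h2 : (fun p => √(α p + β p)) =o[l] fun _ => (1 : ℝ) := by
      rw [Asymptotics.isLittleO_one_iff]
      simpa using hσt.sqrt
    simpa using h1.mul_isLittleO h2
  exact (((hint.add hexp).trans_isLittleO hσr).congr_left
    fun p => by ring).tendsto_div_nhds_zero
end

section
/- The period of the reduced champagne bottle system blows up at the focus-focus point: with T(h, j₂) := √2 ∫_{z₂}^{z₃} dz/√(P(z)), where z₂ < z₃ are the two largest of the three real roots of P(z) = −2z³ + 2z² + 2hz − j₂²/2, one has T(h, j₂) → +∞ as (h, j₂) → (0, 0) within the set {(h, j₂) : h > 0, j₂ ≠ 0}; that is, for every M > 0 there is δ > 0 such that every (h, j₂) with h > 0, j₂ ≠ 0 and h² + j₂² < δ yields three real roots z₁ < z₂ < z₃ of P and T(h, j₂) > M. -/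
open Set MeasureTheory

/-- A cubic `-2z³ + 2z² + 2hz - k` vanishing at three distinct points splits over them. -/
lemma cubic_eq_prod_of_roots {h k a b c : ℝ} (hab : a < b) (hbc : b < c)
    (ha : -2 * a ^ 3 + 2 * a ^ 2 + 2 * h * a - k = 0)
    (hb : -2 * b ^ 3 + 2 * b ^ 2 + 2 * h * b - k = 0)
    (hc : -2 * c ^ 3 + 2 * c ^ 2 + 2 * h * c - k = 0) (z : ℝ) :
    -2 * z ^ 3 + 2 * z ^ 2 + 2 * h * z - k = -2 * (z - a) * (z - b) * (z - c) := by
  have e₁ : a ^ 2 + a * b + b ^ 2 - (a + b) - h = 0 := by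
    apply mul_left_cancel₀ (sub_ne_zero.2 hab.ne)
    linear_combination (hb - ha) / 2
  have e₂ : b ^ 2 + b * c + c ^ 2 - (b + c) - h = 0 := by
    apply mul_left_cancel₀ (sub_ne_zero.2 hbc.ne)
    linear_combination (hc - hb) / 2
  have e₃ : a + b + c - 1 = 0 := by
    apply mul_left_cancel₀ (sub_ne_zero.2 (hab.trans hbc).ne)
    linear_combination e₁ - e₂
  have hh : h = a ^ 2 + a * b + b ^ 2 - (a + b) := by linear_combination -e₁
  have hc' : c = 1 - a - b := by linear_combination e₃
  have hk : k = -2 * a ^ 3 + 2 * a ^ 2 + 2 * h * a := by linear_combination -ha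
  subst hk hh hc'
  ring

lemma intervalIntegrable_inv_sqrt_sub_left {a b : ℝ} (hab : a ≤ b) :
    IntervalIntegrable (fun z => (√(z - a))⁻¹) volume a b := by
  have h := (intervalIntegral.intervalIntegrable_rpow' (a := 0) (b := b - a)
    (r := -(1 / 2)) (by norm_num)).comp_sub_right a
  simp only [zero_add, sub_add_cancel] at h
  refine h.congr fun z hz => ?_
  rw [uIoc_of_le hab] at hz
  have hza : 0 ≤ z - a := by linarith [hz.1]
  simp only [Real.rpow_neg hza, Real.sqrt_eq_rpow]

lemma intervalIntegrable_inv_sqrt_sub_right {a b : ℝ} (hab : a ≤ b) :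
    IntervalIntegrable (fun z => (√(b - z))⁻¹) volume a b := by
  have h := (intervalIntegrable_inv_sqrt_sub_left (sub_nonneg.2 hab)).comp_sub_left b
  simpa using h.symm

/-- The reciprocal square root of a cubic is integrable between its two largest simple roots. -/
lemma intervalIntegrable_inv_sqrt_cubic {a b c : ℝ} (hab : a < b) (hbc : b < c) :
    IntervalIntegrable (fun z => 1 / √(-2 * (z - a) * (z - b) * (z - c))) volume b c := by
  have hm₁ : b < (b + c) / 2 := by linarith
  have hm₂ : (b + c) / 2 < c := by linarith
  refine IntervalIntegrable.trans (b := (b + c) / 2) ?_ ?_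
  · have hg : ContinuousOn (fun z => (√(2 * (z - a) * (c - z)))⁻¹) (uIcc b ((b + c) / 2)) := by
      refine ContinuousOn.inv₀ (by fun_prop) fun z hz => ?_
      rw [uIcc_of_le hm₁.le] at hz
      have h₁ : 0 < z - a := by linarith [hz.1]
      have h₂ : 0 < c - z := by linarith [hz.2]
      positivity
    refine ((intervalIntegrable_inv_sqrt_sub_left hm₁.le).mul_continuousOn hg).congr ?_
    intro z hz
    rw [uIoc_of_le hm₁.le] at hz
    have h₁ : 0 ≤ z - b := by linarith [hz.1]
    simp only [one_div]
    rw [← mul_inv, ← Real.sqrt_mul h₁]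
    ring_nf
  · have hg : ContinuousOn (fun z => (√(2 * (z - a) * (z - b)))⁻¹) (uIcc ((b + c) / 2) c) := by
      refine ContinuousOn.inv₀ (by fun_prop) fun z hz => ?_
      rw [uIcc_of_le hm₂.le] at hz
      have h₁ : 0 < z - a := by linarith [hz.1]
      have h₂ : 0 < z - b := by linarith [hz.1]
      positivity
    refine ((intervalIntegrable_inv_sqrt_sub_right hm₂.le).mul_continuousOn hg).congr ?_
    intro z hz
    rw [uIoc_of_le hm₂.le] at hz
    have h₁ : 0 ≤ c - z := by linarith [hz.2]
    simp only [one_div]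
    rw [← mul_inv, ← Real.sqrt_mul h₁]
    ring_nf

/-- A logarithmic lower bound for the period integral in terms of the gaps between the roots. -/
lemma log_le_integral_inv_sqrt_cubic {a b c : ℝ} (hab : a < b) (hbc : b < c) (hc : c ≤ b + 2) :
    1 / 2 * Real.log ((c - a) / (b - a)) ≤
      ∫ z in b..c, 1 / √(-2 * (z - a) * (z - b) * (z - c)) := by
  have hnot : (0 : ℝ) ∉ uIcc (b - a) (c - a) := by
    rw [uIcc_of_le (by linarith)]
    exact fun h => by linarith [h.1]
  have hlog : ∫ z in b..c, 1 / 2 * (z - a)⁻¹ = 1 / 2 * Real.log ((c - a) / (b - a)) := by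
    rw [intervalIntegral.integral_const_mul,
      intervalIntegral.integral_comp_sub_right (fun x => x⁻¹), integral_inv hnot]
  rw [← hlog]
  refine intervalIntegral.integral_mono_on_of_le_Ioo hbc.le ?_
    (intervalIntegrable_inv_sqrt_cubic hab hbc) fun z hz => ?_
  · refine ContinuousOn.intervalIntegrable (continuousOn_const.mul
      (ContinuousOn.inv₀ (by fun_prop) fun z hz => ?_))
    rw [uIcc_of_le hbc.le] at hz
    linarith [hz.1]
  · have h₁ : 0 < z - b := by linarith [hz.1]
    have h₂ : 0 < c - z := by linarith [hz.2]
    have h₃ : 0 < z - a := by linarith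
    have hpos : 0 < -2 * (z - a) * (z - b) * (z - c) := by
      have : 0 < 2 * (z - a) * (z - b) * (c - z) := by positivity
      linarith
    have hle : √(-2 * (z - a) * (z - b) * (z - c)) ≤ 2 * (z - a) := by
      refine Real.sqrt_le_iff.2 ⟨by positivity, ?_⟩
      have k₁ : (z - b) * (c - z) ≤ (z - a) * 2 :=
        mul_le_mul (by linarith) (by linarith) h₂.le h₃.le
      nlinarith [mul_le_mul_of_nonneg_left k₁ h₃.le]
    calc 1 / 2 * (z - a)⁻¹ = 1 / (2 * (z - a)) := by field_simp
      _ ≤ _ := one_div_le_one_div_of_le (Real.sqrt_pos.2 hpos) hle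

/-- For small parameters the cubic has roots in `(-ε, 0)`, `(0, ε)` and `(1 / 2, 2)`. -/
lemma exists_roots_champagne_cubic {ε h k : ℝ} (hε : 0 < ε) (hε' : ε ≤ 1 / 8) (hh : 0 < h)
    (hhε : h < ε / 2) (hk : 0 < k) (hkε : k < ε ^ 2) :
    ∃ a ∈ Ioo (-ε) 0, ∃ b ∈ Ioo 0 ε, ∃ c ∈ Ioo (1 / 2 : ℝ) 2,
      -2 * a ^ 3 + 2 * a ^ 2 + 2 * h * a - k = 0 ∧
      -2 * b ^ 3 + 2 * b ^ 2 + 2 * h * b - k = 0 ∧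
      -2 * c ^ 3 + 2 * c ^ 2 + 2 * h * c - k = 0 := by
  let P : ℝ → ℝ := fun z => -2 * z ^ 3 + 2 * z ^ 2 + 2 * h * z - k
  have hP : Continuous P := by fun_prop
  have hzero : P 0 < 0 := by simp [P, hk]
  have hneg : 0 < P (-ε) := by
    simp only [P]
    nlinarith [pow_pos hε 3, mul_pos hε (sub_pos.2 hhε)]
  have hpos : 0 < P ε := by
    simp only [P]
    nlinarith [mul_pos hε hh, mul_nonneg (sq_nonneg ε) (sub_nonneg.2 hε')]
  have hhalf : 0 < P (1 / 2) := by
    simp only [P]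
    nlinarith
  have htwo : P 2 < 0 := by
    simp only [P]
    linarith
  obtain ⟨a, ha, ha'⟩ := intermediate_value_Ioo' (by linarith) hP.continuousOn ⟨hzero, hneg⟩
  obtain ⟨b, hb, hb'⟩ := intermediate_value_Ioo hε.le hP.continuousOn ⟨hzero, hpos⟩
  obtain ⟨c, hc, hc'⟩ := intermediate_value_Ioo' (by norm_num) hP.continuousOn ⟨htwo, hhalf⟩
  exact ⟨a, ha, b, hb, c, hc, ha', hb', hc'⟩

/-- the period T(h, j₂) = √2 ∫_{z₂}^{z₃} dz/√(P(z)) of the reduced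
champagne bottle system blows up as (h, j₂) → (0, 0) within {h > 0, j₂ ≠ 0}, where
z₂ < z₃ are the two largest of the three real roots of
P(z) = −2z³ + 2z² + 2hz − j₂²/2. -/
theorem champagne_bottle_period_blowup :
    ∀ M : ℝ, 0 < M → ∃ δ : ℝ, 0 < δ ∧
      ∀ h j₂ : ℝ, 0 < h → j₂ ≠ 0 → h^2 + j₂^2 < δ →
        ∃ z₁ z₂ z₃ : ℝ, z₁ < z₂ ∧ z₂ < z₃ ∧
          (∀ z : ℝ, -2 * z^3 + 2 * z^2 + 2 * h * z - j₂^2 / 2 =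
            -2 * (z - z₁) * (z - z₂) * (z - z₃)) ∧
          Real.sqrt 2 *
            (∫ z in z₂..z₃,
              1 / Real.sqrt (-2 * z^3 + 2 * z^2 + 2 * h * z - j₂^2 / 2)) > M := by
  intro M hM
  set ε : ℝ := Real.exp (-(2 * M)) / 8 with hε_def
  have hε : 0 < ε := by positivity
  have hε' : ε ≤ 1 / 8 := by
    have : Real.exp (-(2 * M)) ≤ 1 := Real.exp_le_one_iff.2 (by linarith)
    linarith
  refine ⟨ε ^ 2 / 4, by positivity, fun h j hh hj hδ => ?_⟩
  have hj2 : 0 < j ^ 2 := by positivity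
  have hhε : h < ε / 2 := by nlinarith
  obtain ⟨a, ha, b, hb, c, hc, ha', hb', hc'⟩ := exists_roots_champagne_cubic hε hε' hh hhε
    (k := j ^ 2 / 2) (by positivity) (by nlinarith)
  have hab : a < b := ha.2.trans hb.1
  have hbc : b < c := by linarith [hb.2, hc.1]
  have hfac := cubic_eq_prod_of_roots hab hbc ha' hb' hc'
  refine ⟨a, b, c, hab, hbc, hfac, ?_⟩
  simp only [hfac]
  have hint := log_le_integral_inv_sqrt_cubic hab hbc (by linarith [hb.1, hc.2])
  have hlog : 2 * M < Real.log ((c - a) / (b - a)) := by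
    have hba : 0 < b - a := by linarith
    rw [Real.lt_log_iff_exp_lt (div_pos (by linarith) hba), lt_div_iff₀ hba]
    have hprod : Real.exp (2 * M) * ε = 1 / 8 := by
      rw [hε_def, ← mul_div_assoc, ← Real.exp_add]
      simp
    have : Real.exp (2 * M) * (b - a) ≤ Real.exp (2 * M) * (2 * ε) :=
      mul_le_mul_of_nonneg_left (by linarith [ha.1, hb.2]) (Real.exp_pos _).le
    linarith [hc.1, ha.2]
  have hsqrt : 1 ≤ √(2 : ℝ) := Real.one_le_sqrt.2 (by norm_num)
  nlinarith
end

section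
/- The set of critical values of the momentum map of the champagne bottle is the origin together with the curve parameterized by r ≥ 1/√2: a point (h, j₂) ∈ ℝ² is a critical value of F = (H, J₂) : ℝ⁴ → ℝ² (i.e. there exists m ∈ ℝ⁴ with F(m) = (h, j₂) such that the derivative DF(m) : ℝ⁴ → ℝ² is not surjective) if and only if (h, j₂) = (0, 0) or there exists r ≥ 1/√2 with h = 3r⁴ − 2r² and j₂² = 4r⁶ − 2r⁴. -/
/-- The momentum map F = (H, J₂) of the champagne bottle on ℝ⁴ = ℝ×ℝ×ℝ×ℝ,
with coordinates (x₁, x₂, y₁, y₂). -/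
noncomputable def champF : ℝ × ℝ × ℝ × ℝ → ℝ × ℝ := fun p =>
  ((1/2) * (p.2.2.1^2 + p.2.2.2^2) - (p.1^2 + p.2.1^2) + (p.1^2 + p.2.1^2)^2,
   p.1 * p.2.2.2 - p.2.1 * p.2.2.1)

/-- The derivative of the momentum map in coordinates. -/
theorem fderiv_champF_apply (x₁ x₂ y₁ y₂ : ℝ) (v : ℝ × ℝ × ℝ × ℝ) :
    fderiv ℝ champF (x₁, x₂, y₁, y₂) v =
      ((4 * (x₁ ^ 2 + x₂ ^ 2) - 2) * (x₁ * v.1 + x₂ * v.2.1) + y₁ * v.2.2.1 + y₂ * v.2.2.2,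
        y₂ * v.1 - y₁ * v.2.1 - x₂ * v.2.2.1 + x₁ * v.2.2.2) := by
  set m : ℝ × ℝ × ℝ × ℝ := (x₁, x₂, y₁, y₂) with hm
  have hx₁ := hasFDerivAt_fst (𝕜 := ℝ) (p := m)
  have h₂ := hasFDerivAt_snd (𝕜 := ℝ) (p := m)
  have hx₂ := h₂.fst
  have hy₁ := h₂.snd.fst
  have hy₂ := h₂.snd.snd
  have hρ := (hx₁.pow 2).add (hx₂.pow 2)
  have hF : HasFDerivAt champF _ m :=
    (((((hy₁.pow 2).add (hy₂.pow 2)).const_mul (1 / 2)).sub hρ).add (hρ.pow 2)).prodMk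
      ((hx₁.mul hy₂).sub (hx₂.mul hy₁))
  rw [hF.fderiv]
  ext <;> simp [hm] <;> ring

/-- A linear map to the plane is surjective as soon as two of its values have nonzero
determinant. -/
theorem surjective_of_det_ne_zero {E : Type*} [AddCommGroup E] [Module ℝ E]
    (L : E →ₗ[ℝ] ℝ × ℝ) (u w : E)
    (hdet : (L u).1 * (L w).2 - (L u).2 * (L w).1 ≠ 0) : Function.Surjective L := by
  rintro ⟨a, b⟩
  set δ := (L u).1 * (L w).2 - (L u).2 * (L w).1 with hδ
  refine ⟨((a * (L w).2 - b * (L w).1) / δ) • u + ((b * (L u).1 - a * (L u).2) / δ) • w, ?_⟩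
  ext
  · simp only [map_add, map_smul, Prod.fst_add, Prod.smul_fst, smul_eq_mul]
    field_simp
    rw [hδ]
    ring
  · simp only [map_add, map_smul, Prod.snd_add, Prod.smul_snd, smul_eq_mul]
    field_simp
    rw [hδ]
    ring

/-- At a critical point, three of the minors of the derivative give the critical equations. -/
theorem critical_equations {x₁ x₂ y₁ y₂ : ℝ}
    (hcrit : ¬ Function.Surjective (fderiv ℝ champF (x₁, x₂, y₁, y₂))) :
    (4 * (x₁ ^ 2 + x₂ ^ 2) - 2) * x₁ ^ 2 = y₂ ^ 2 ∧
      (4 * (x₁ ^ 2 + x₂ ^ 2) - 2) * x₂ ^ 2 = y₁ ^ 2 ∧ x₁ * y₁ + x₂ * y₂ = 0 := by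
  have minor (u w : ℝ × ℝ × ℝ × ℝ) := not_imp_comm.1
    (surjective_of_det_ne_zero (fderiv ℝ champF (x₁, x₂, y₁, y₂)).toLinearMap u w) hcrit
  simp only [ContinuousLinearMap.coe_coe, fderiv_champF_apply] at minor
  have h₁₄ := minor (1, 0, 0, 0) (0, 0, 0, 1)
  have h₂₃ := minor (0, 1, 0, 0) (0, 0, 1, 0)
  have h₃₄ := minor (0, 0, 1, 0) (0, 0, 0, 1)
  ring_nf at h₁₄ h₂₃ h₃₄
  exact ⟨by linear_combination h₁₄, by linear_combination -h₂₃, by linear_combination h₃₄⟩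

theorem not_surjective_fderiv_champF_zero :
    ¬ Function.Surjective (fderiv ℝ champF (0, 0, 0, 0)) := by
  intro hsurj
  obtain ⟨v, hv⟩ := hsurj (1, 0)
  simp [fderiv_champF_apply] at hv

/-- The points of the relative equilibria on the `x₁`-axis are critical. -/
theorem not_surjective_fderiv_champF_of_sq_eq {r s : ℝ} (hr : r ≠ 0)
    (hs : s ^ 2 = (4 * r ^ 2 - 2) * r ^ 2) :
    ¬ Function.Surjective (fderiv ℝ champF (r, 0, 0, s)) := by
  intro hsurj
  obtain ⟨v, hv⟩ := hsurj (1, 0)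
  rw [fderiv_champF_apply, Prod.mk.injEq] at hv
  obtain ⟨hH, hJ⟩ := hv
  exact hr (by linear_combination s * hJ - r * hH - v.1 * hs)

/-- (h, j₂) is a critical value of the momentum map F = (H, J₂)
(i.e. some preimage point has non-surjective derivative DF) iff (h, j₂) = (0, 0) or
(h, j₂) lies on the curve h = 3r⁴ − 2r², j₂² = 4r⁶ − 2r⁴ for some r ≥ 1/√2. -/
theorem champagne_bottle_critical_values (h j₂ : ℝ) :
    (∃ m : ℝ × ℝ × ℝ × ℝ, champF m = (h, j₂) ∧
      ¬ Function.Surjective (fderiv ℝ champF m)) ↔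
    ((h, j₂) = (0, 0) ∨
      ∃ r : ℝ, 1 / Real.sqrt 2 ≤ r ∧ h = 3 * r^4 - 2 * r^2 ∧ j₂^2 = 4 * r^6 - 2 * r^4) := by
  constructor
  · rintro ⟨⟨x₁, x₂, y₁, y₂⟩, hval, hcrit⟩
    obtain ⟨h₁₄, h₂₃, h₃₄⟩ := critical_equations hcrit
    obtain ⟨rfl, rfl⟩ := Prod.mk.inj hval
    simp only
    rcases eq_or_ne (x₁ ^ 2 + x₂ ^ 2) 0 with hρ | hρ
    · left
      have hx₁ : x₁ = 0 := by nlinarith [sq_nonneg x₁, sq_nonneg x₂]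
      have hx₂ : x₂ = 0 := by nlinarith [sq_nonneg x₁, sq_nonneg x₂]
      subst hx₁ hx₂
      have hy₂ : y₂ = 0 := by simpa using h₁₄.symm
      have hy₁ : y₁ = 0 := by simpa using h₂₃.symm
      simp [hy₁, hy₂]
    · right
      have hρpos : 0 < x₁ ^ 2 + x₂ ^ 2 := lt_of_le_of_ne (by positivity) hρ.symm
      have hk : 0 ≤ 4 * (x₁ ^ 2 + x₂ ^ 2) - 2 := by
        refine nonneg_of_mul_nonneg_left (b := x₁ ^ 2 + x₂ ^ 2) ?_ hρpos
        rw [mul_add, h₁₄, h₂₃]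
        positivity
      have hr : √(x₁ ^ 2 + x₂ ^ 2) ^ 2 = x₁ ^ 2 + x₂ ^ 2 := Real.sq_sqrt hρpos.le
      refine ⟨√(x₁ ^ 2 + x₂ ^ 2), ?_, ?_, ?_⟩
      · rw [one_div, ← Real.sqrt_inv]
        exact Real.sqrt_le_sqrt (by linarith)
      · rw [show 4 = 2 * 2 from rfl, pow_mul, hr]
        linear_combination -(1 / 2) * h₁₄ - (1 / 2) * h₂₃
      · rw [show 6 = 2 * 3 from rfl, show 4 = 2 * 2 from rfl, pow_mul, pow_mul, hr]
        linear_combination -(x₁ ^ 2 + x₂ ^ 2) * h₁₄ - (x₁ ^ 2 + x₂ ^ 2) * h₂₃ -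
          (x₁ * y₁ + x₂ * y₂) * h₃₄
  · rintro (h0 | ⟨r, hr, rfl, hj⟩)
    · exact ⟨(0, 0, 0, 0), by simp [champF, h0], not_surjective_fderiv_champF_zero⟩
    · have hr0 : r ≠ 0 := (lt_of_lt_of_le (by positivity) hr).ne'
      have hs : (j₂ / r) ^ 2 = (4 * r ^ 2 - 2) * r ^ 2 := by
        rw [div_pow, hj]
        field_simp
      refine ⟨(r, 0, 0, j₂ / r), ?_, not_surjective_fderiv_champF_of_sq_eq hr0 hs⟩
      simp only [champF, Prod.mk.injEq]
      constructor
      · linear_combination (1 / 2) * hs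
      · field_simp
        ring
end
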